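/- μ(I^ω) = 1, where I^ω = [0,1]^ℕ is the Hilbert cube regarded as a subset of M_a. -/

import Mathlib

open Filter

noncomputable section

/-- Fix a sequence `a` of positive reals with `∑ aᵢ² < ∞`.  The space
`M_a` consists of the real sequences `x` with `∑ aᵢ² xᵢ² < ∞`. -/
def Ma (a : ℕ → ℝ) : Set (ℕ → ℝ) := {x | Summable fun i => (a i) ^ 2 * (x i) ^ 2}

/-- The inner product `⟨x,y⟩_a = ∑ aᵢ² xᵢ yᵢ` on `M_a`. -/
def innerA (a : ℕ → ℝ) (x y : ℕ → ℝ) : ℝ := ∑' i, (a i) ^ 2 * (x i * y i)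

/-- The metric `d_a(x,y) = (∑ aᵢ² (xᵢ - yᵢ)²)^{1/2}`. -/
def da (a : ℕ → ℝ) (x y : ℕ → ℝ) : ℝ := Real.sqrt (∑' i, (a i) ^ 2 * (x i - y i) ^ 2)

/-- `eᵢ`: the sequence with `1` in the `i`-th coordinate and `0` elsewhere. -/
def eSeq (i : ℕ) : ℕ → ℝ := Pi.single i 1

/-- `Λ(E) = {i | ∃ x ∈ E, ∃ α ≠ 0, x + α eᵢ ∈ E}`. -/
def Lam (E : Set (ℕ → ℝ)) : Set ℕ :=
  {i | ∃ x ∈ E, ∃ α : ℝ, α ≠ 0 ∧ x + α • eSeq i ∈ E}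

/-- Convergence of the series `∑ᵢ f i` to `s` in `M_a`: the partial sums
converge to `s` with respect to the metric `d_a`. -/
def ConvSeries (a : ℕ → ℝ) (f : ℕ → ℕ → ℝ) (s : ℕ → ℝ) : Prop :=
  Tendsto (fun n => da a (∑ i ∈ Finset.range n, f i) s) atTop (nhds 0)

/-- The generalized linear span `GS(E,p)`: all points `p + ∑ᵢ αᵢ (xᵢ - p) ∈ M_a`
with `xᵢ ∈ E`, `αᵢ ∈ ℝ`, the series converging in `M_a`. -/
def GS (a : ℕ → ℝ) (E : Set (ℕ → ℝ)) (p : ℕ → ℝ) : Set (ℕ → ℝ) :=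
  {u | u ∈ Ma a ∧ ∃ x : ℕ → ℕ → ℝ, ∃ α : ℕ → ℝ,
    (∀ i, x i ∈ E) ∧ ConvSeries a (fun i => α i • (x i - p)) (u - p)}

/-- `E` is a `d_a`-bounded set. -/
def BoundedA (a : ℕ → ℝ) (E : Set (ℕ → ℝ)) : Prop :=
  ∃ C : ℝ, ∀ x ∈ E, ∀ y ∈ E, da a x y ≤ C

/-- `f` is a `d_a`-isometry on `E`. -/
def IsIsomOn (a : ℕ → ℝ) (f : (ℕ → ℝ) → ℕ → ℝ) (E : Set (ℕ → ℝ)) : Prop :=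
  ∀ x ∈ E, ∀ y ∈ E, da a (f x) (f y) = da a x y

/-- Data for a basic cylinder: each factor is a nonempty closed subinterval
`[lo i, hi i] ⊆ [0,1]`, and all but finitely many factors equal `[0,1]`. -/
def IsBCData (lo hi : ℕ → ℝ) : Prop :=
  (∀ i, 0 ≤ lo i) ∧ (∀ i, lo i ≤ hi i) ∧ (∀ i, hi i ≤ 1) ∧
    {i | ¬(lo i = 0 ∧ hi i = 1)}.Finite

/-- The product set `∏ᵢ [lo i, hi i]`. -/
def cylSet (lo hi : ℕ → ℝ) : Set (ℕ → ℝ) := {x | ∀ i, x i ∈ Set.Icc (lo i) (hi i)}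

/-- `J` is a basic cylinder. -/
def IsBasicCylinder (J : Set (ℕ → ℝ)) : Prop :=
  ∃ lo hi : ℕ → ℝ, IsBCData lo hi ∧ J = cylSet lo hi

/-- The elementary volume of a basic cylinder: the product of the lengths of its
edges (a finite product; it is `0` exactly when some factor is a singleton). -/
def bcVol (lo hi : ℕ → ℝ) : ℝ := ∏ᶠ i, (hi i - lo i)

/-- `K` is a cylinder of volume `v`: there are a basic cylinder of elementary
volume `v` and a surjective `d_a`-isometry from it onto `K`. -/
def IsCylVol (a : ℕ → ℝ) (K : Set (ℕ → ℝ)) (v : ℝ) : Prop :=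
  ∃ lo hi : ℕ → ℝ, IsBCData lo hi ∧ v = bcVol lo hi ∧
    ∃ f : (ℕ → ℝ) → ℕ → ℝ, IsIsomOn a f (cylSet lo hi) ∧ f '' cylSet lo hi = K

/-- `K` is a cylinder. -/
def IsCylinder (a : ℕ → ℝ) (K : Set (ℕ → ℝ)) : Prop := ∃ v : ℝ, IsCylVol a K v

/-- The `d_a`-diameter of a set. -/
def daDiam (a : ℕ → ℝ) (K : Set (ℕ → ℝ)) : ℝ := sSup (Set.image2 (da a) K K)

/-- `μ_δ(E)`: the infimum of `∑ vol(Kᵢ)` over countable coverings of `E` by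
cylinders of `d_a`-diameter `< δ` (`∞` if no such covering exists). -/
def preMu (a : ℕ → ℝ) (δ : ℝ) (E : Set (ℕ → ℝ)) : ENNReal :=
  sInf {m : ENNReal | ∃ (K : ℕ → Set (ℕ → ℝ)) (v : ℕ → ℝ),
    (∀ n, IsCylVol a (K n) (v n)) ∧ (∀ n, daDiam a (K n) < δ) ∧
    (E ⊆ ⋃ n, K n) ∧ m = ∑' n, ENNReal.ofReal (v n)}

/-- The outer measure `μ(E) = lim_{δ→0⁺} μ_δ(E) = sup_{δ>0} μ_δ(E)`. -/
def muA (a : ℕ → ℝ) (E : Set (ℕ → ℝ)) : ENNReal :=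
  ⨆ (δ : ℝ) (_ : 0 < δ), preMu a δ E

/-- The Hilbert cube `I^ω = [0,1]^ℕ`, viewed as a subset of `M_a`. -/
def cube : Set (ℕ → ℝ) := {x | ∀ i, x i ∈ Set.Icc (0 : ℝ) 1}

section Levels

open MeasureTheory
open scoped Classical ENNReal

/-- The data of the level-set argument: a matrix `p` of squared cosines, the squared scales
`h`, `k`, and the excess `e` and defect `D` of the rows. -/
structure LevelData (p : ℕ → ℕ → ℝ) (h k e D r : ℕ → ℝ) (n0 : ℕ) (b K : ℝ) : Prop where
  p_nonneg : ∀ i j, 0 ≤ p i j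
  col : ∀ j, HasSum (fun i => p i j) 1
  row_summable : ∀ i, Summable (p i)
  row : ∀ i, ∑' j, p i j ≤ 1
  h_pos : ∀ j, 0 < h j
  h_le : ∀ j, h j ≤ k j
  h_eq : ∀ j, n0 ≤ j → h j = k j
  k_summable : Summable k
  D_nonneg : ∀ j, 0 ≤ D j
  D_summable : Summable D
  e_nonneg : ∀ i, 0 ≤ e i
  b_pos : 0 < b
  K_pos : 0 < K
  D_le : ∀ j, D j ≤ b / 2
  balance : ∀ i, k i * (1 + r i) = k i * e i + ∑' j, p i j * h j
  row_cases : ∀ i, (r i = 0 ∧ 1 ≤ K * e i) ∨ ∃ s, r i = D s ∧ b * k i ≤ p i s * h s ∧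
    (∑' j, p i j * h j) - p i s * h s ≤ K * e i * k i

namespace LevelData

variable {p : ℕ → ℕ → ℝ} {h k e D r : ℕ → ℝ} {n0 : ℕ} {b K : ℝ}

/-- The sum of the nonnegative reals `f i j` over the pairs satisfying `c`. -/
def dsum (c : ℕ → ℕ → Prop) (f : ℕ → ℕ → ℝ) : ℝ≥0∞ :=
  ∑' i, ∑' j, if c i j then ENNReal.ofReal (f i j) else 0

theorem dsum_add {c : ℕ → ℕ → Prop} {f g : ℕ → ℕ → ℝ}
    (hf : ∀ i j, c i j → 0 ≤ f i j) (hg : ∀ i j, c i j → 0 ≤ g i j) :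
    dsum c f + dsum c g = dsum c (fun i j => f i j + g i j) := by
  unfold dsum
  rw [← ENNReal.tsum_add]
  refine tsum_congr fun i => ?_
  rw [← ENNReal.tsum_add]
  refine tsum_congr fun j => ?_
  split_ifs with hc
  · rw [ENNReal.ofReal_add (hf i j hc) (hg i j hc)]
  · simp

theorem dsum_mul {c : ℕ → ℕ → Prop} {f : ℕ → ℕ → ℝ} {t : ℝ} (ht : 0 ≤ t) :
    dsum c (fun i j => t * f i j) = ENNReal.ofReal t * dsum c f := by
  unfold dsum
  rw [← ENNReal.tsum_mul_left]
  refine tsum_congr fun i => ?_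
  rw [← ENNReal.tsum_mul_left]
  refine tsum_congr fun j => ?_
  split_ifs with hc
  · rw [ENNReal.ofReal_mul ht]
  · simp

theorem dsum_split (c d : ℕ → ℕ → Prop) (f : ℕ → ℕ → ℝ) :
    dsum c f = dsum (fun i j => c i j ∧ d i j) f + dsum (fun i j => c i j ∧ ¬ d i j) f := by
  unfold dsum
  rw [← ENNReal.tsum_add]
  refine tsum_congr fun i => ?_
  rw [← ENNReal.tsum_add]
  refine tsum_congr fun j => ?_
  by_cases hc : c i j <;> by_cases hd : d i j <;> simp [hc, hd]

theorem dsum_congr {c d : ℕ → ℕ → Prop} {f g : ℕ → ℕ → ℝ} (hcd : ∀ i j, c i j ↔ d i j)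
    (hfg : ∀ i j, c i j → f i j = g i j) : dsum c f = dsum d g := by
  unfold dsum
  refine tsum_congr fun i => tsum_congr fun j => ?_
  by_cases hc : c i j
  · rw [if_pos hc, if_pos ((hcd i j).1 hc), hfg i j hc]
  · rw [if_neg hc, if_neg (fun hd => hc ((hcd i j).2 hd))]

theorem dsum_mono {c d : ℕ → ℕ → Prop} {f g : ℕ → ℕ → ℝ} (hcd : ∀ i j, c i j → d i j)
    (hfg : ∀ i j, c i j → f i j ≤ g i j) : dsum c f ≤ dsum d g := by
  unfold dsum
  refine ENNReal.tsum_le_tsum fun i => ENNReal.tsum_le_tsum fun j => ?_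
  by_cases hc : c i j
  · rw [if_pos hc, if_pos (hcd i j hc)]; exact ENNReal.ofReal_le_ofReal (hfg i j hc)
  · rw [if_neg hc]; exact zero_le

/-- The sum of the nonnegative reals `f i` over the indices satisfying `c`. -/
def ssum (c : ℕ → Prop) (f : ℕ → ℝ) : ℝ≥0∞ := ∑' i, if c i then ENNReal.ofReal (f i) else 0

theorem dsum_left (H : LevelData p h k e D r n0 b K) (c : ℕ → Prop) :
    dsum (fun i _ => c i) (fun i j => p i j * h j) = ssum c (fun i => ∑' j, p i j * h j) := by
  unfold dsum ssum
  refine tsum_congr fun i => ?_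
  by_cases hc : c i
  · simp only [hc, if_true]
    rw [ENNReal.ofReal_tsum_of_nonneg]
    · exact fun j => mul_nonneg (H.p_nonneg i j) (H.h_pos j).le
    · obtain ⟨M, hM⟩ := H.k_summable.tendsto_atTop_zero.bddAbove_range
      refine Summable.of_nonneg_of_le (fun j => mul_nonneg (H.p_nonneg i j) (H.h_pos j).le)
        (fun j => ?_) ((H.row_summable i).mul_right M)
      exact mul_le_mul_of_nonneg_left ((H.h_le j).trans (hM ⟨j, rfl⟩)) (H.p_nonneg i j)
  · simp [hc]

theorem dsum_right (H : LevelData p h k e D r n0 b K) (c : ℕ → Prop) (f : ℕ → ℝ)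
    (hf : ∀ j, 0 ≤ f j) :
    dsum (fun _ j => c j) (fun i j => p i j * f j) = ssum c f := by
  unfold dsum ssum
  rw [ENNReal.tsum_comm]
  refine tsum_congr fun j => ?_
  by_cases hc : c j
  · simp only [hc, if_true]
    rw [← ENNReal.ofReal_tsum_of_nonneg, tsum_mul_right, (H.col j).tsum_eq, one_mul]
    · exact fun i => mul_nonneg (H.p_nonneg i j) (hf j)
    · exact (H.col j).summable.mul_right _
  · simp [hc]

theorem ssum_add {c : ℕ → Prop} {f g : ℕ → ℝ}
    (hf : ∀ i, c i → 0 ≤ f i) (hg : ∀ i, c i → 0 ≤ g i) :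
    ssum c f + ssum c g = ssum c (fun i => f i + g i) := by
  unfold ssum
  rw [← ENNReal.tsum_add]
  refine tsum_congr fun i => ?_
  split_ifs with hc
  · rw [ENNReal.ofReal_add (hf i hc) (hg i hc)]
  · simp

theorem ssum_congr {c d : ℕ → Prop} {f g : ℕ → ℝ} (hcd : ∀ i, c i ↔ d i)
    (hfg : ∀ i, c i → f i = g i) : ssum c f = ssum d g := by
  unfold ssum
  refine tsum_congr fun i => ?_
  by_cases hc : c i
  · rw [if_pos hc, if_pos ((hcd i).1 hc), hfg i hc]
  · rw [if_neg hc, if_neg (fun hd => hc ((hcd i).2 hd))]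

theorem ssum_ne_top {c : ℕ → Prop} {f : ℕ → ℝ} (h0 : ∀ i, 0 ≤ f i) (hf : Summable f) :
    ssum c f ≠ ∞ := by
  have h1 : ssum c f ≤ ∑' i, ENNReal.ofReal (f i) :=
    ENNReal.tsum_le_tsum fun i => by split_ifs <;> simp
  rw [← ENNReal.ofReal_tsum_of_nonneg h0 hf] at h1
  exact (h1.trans_lt ENNReal.ofReal_lt_top).ne

theorem r_nonneg (H : LevelData p h k e D r n0 b K) (i : ℕ) : 0 ≤ r i := by
  rcases H.row_cases i with h1 | ⟨s, h1, -⟩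
  · exact h1.1.ge
  · rw [h1]; exact H.D_nonneg s

theorem k_pos (H : LevelData p h k e D r n0 b K) (i : ℕ) : 0 < k i :=
  (H.h_pos i).trans_le (H.h_le i)

/-- Balance of the mass entering and leaving a level set `N`. -/
theorem balance_level (H : LevelData p h k e D r n0 b K) (N : Set ℕ)
    (hN : ∀ j, j ∉ N → h j = k j) :
    dsum (fun i j => i ∉ N ∧ j ∈ N) (fun i j => p i j * h j)
        + ssum (fun i => i ∉ N) (fun i => k i * e i)
      = dsum (fun i j => i ∈ N ∧ j ∉ N) (fun i j => p i j * h j)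
        + ssum (fun i => i ∉ N) (fun i => k i * r i) := by
  set X := dsum (fun i j => i ∈ N ∧ j ∉ N) (fun i j => p i j * h j)
  set Y := dsum (fun i j => i ∉ N ∧ j ∈ N) (fun i j => p i j * h j)
  set Z := dsum (fun i j => i ∉ N ∧ j ∉ N) (fun i j => p i j * h j) with hZ
  set E := ssum (fun i => i ∉ N) (fun i => k i * e i)
  set R := ssum (fun i => i ∉ N) (fun i => k i * r i)
  have h1 : X + Z = ssum (fun i => i ∉ N) k := by
    rw [← ssum_congr (c := fun i => i ∉ N) (fun i => Iff.rfl) hN,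
      ← H.dsum_right (fun i => i ∉ N) h (fun j => (H.h_pos j).le),
      dsum_split (fun i j => j ∉ N) (fun i j => i ∈ N)]
    congr 1 <;> exact dsum_congr (fun i j => by tauto) (fun _ _ _ => rfl)
  have h2 : Y + Z = ssum (fun i => i ∉ N) (fun i => ∑' j, p i j * h j) := by
    rw [← H.dsum_left, dsum_split (fun i j => i ∉ N) (fun i j => j ∈ N)]
  have h3 : ssum (fun i => i ∉ N) k + R = E + (Y + Z) := by
    rw [h2, ssum_add, ssum_add]
    · refine ssum_congr (fun _ => Iff.rfl) fun i _ => ?_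
      rw [← H.balance i]; ring
    · exact fun i _ => mul_nonneg (H.k_pos i).le (H.e_nonneg i)
    · exact fun i _ => tsum_nonneg fun j => mul_nonneg (H.p_nonneg i j) (H.h_pos j).le
    · exact fun i _ => (H.k_pos i).le
    · exact fun i _ => mul_nonneg (H.k_pos i).le (H.r_nonneg i)
  have hZt : Z ≠ ∞ := by
    refine ne_top_of_le_ne_top (ssum_ne_top (c := fun i => i ∉ N) (fun i => (H.k_pos i).le)
      H.k_summable) (h1 ▸ le_add_self)
  rw [← h1] at h3
  refine (ENNReal.add_left_inj hZt).1 ?_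
  rw [add_right_comm X R Z, h3]; ring

theorem crossing_le (H : LevelData p h k e D r n0 b K) {N : Set ℕ} (hN : N.Finite) :
    dsum (fun i j => i ∈ N ∧ j ∉ N) p ≤ dsum (fun i j => i ∉ N ∧ j ∈ N) p := by
  set Z := dsum (fun i j => i ∈ N ∧ j ∈ N) p
  have h1 : dsum (fun i j => i ∉ N ∧ j ∈ N) p + Z = ssum (fun j => j ∈ N) (fun _ => 1) := by
    rw [← H.dsum_right (fun i => i ∈ N) (fun _ => 1) (fun j => zero_le_one),
      dsum_split (fun i j => j ∈ N) (fun i j => i ∈ N), add_comm]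
    congr 1 <;> exact dsum_congr (fun i j => by tauto) (fun _ _ _ => (mul_one _).symm)
  have h2 : dsum (fun i j => i ∈ N ∧ j ∉ N) p + Z ≤ ssum (fun j => j ∈ N) (fun _ => 1) := by
    rw [add_comm, ← dsum_split (fun i j => i ∈ N) (fun i j => j ∈ N)]
    refine ENNReal.tsum_le_tsum fun i => ?_
    by_cases hi : i ∈ N
    · simp only [hi, if_true]
      rw [← ENNReal.ofReal_tsum_of_nonneg (H.p_nonneg i) (H.row_summable i)]
      exact ENNReal.ofReal_le_ofReal (H.row i)
    · simp [hi]
  have h3 : ssum (fun j => j ∈ N) (fun _ => (1 : ℝ)) ≠ ∞ := by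
    have : ssum (fun j => j ∈ N) (fun _ => (1 : ℝ)) = ∑ j ∈ hN.toFinset, 1 := by
      unfold ssum
      rw [tsum_eq_sum (s := hN.toFinset)]
      · refine Finset.sum_congr rfl fun i hi => ?_
        rw [Set.Finite.mem_toFinset] at hi
        simp [hi]
      · intro i hi
        rw [Set.Finite.mem_toFinset] at hi
        simp [hi]
    rw [this]
    simp
  rw [← h1] at h2 h3
  exact (ENNReal.add_le_add_iff_right (ne_top_of_le_ne_top h3 le_add_self)).1 h2

/-- The defect of the rows outside a level set is absorbed. -/
theorem defect_le (H : LevelData p h k e D r n0 b K) {θ : ℝ} (hθ : 0 < θ) (N : Set ℕ)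
    (hN : ∀ j, j ∈ N ↔ θ ≤ h j) :
    ssum (fun i => i ∉ N) (fun i => k i * r i) ≤
      dsum (fun i j => i ∉ N ∧ j ∈ N) (fun i j => p i j * (h j - θ))
        + ssum (fun j => h j < 2 * θ) (fun j => D j * h j / b) := by
  have h1 : ssum (fun j => h j < 2 * θ) (fun j => D j * h j / b)
      = dsum (fun _ j => h j < 2 * θ) (fun i j => p i j * (D j * h j / b)) := by
    rw [H.dsum_right (fun j => h j < 2 * θ) (fun j => D j * h j / b)]
    exact fun j => div_nonneg (mul_nonneg (H.D_nonneg j) (H.h_pos j).le) H.b_pos.le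
  rw [h1]
  unfold dsum
  rw [← ENNReal.tsum_add]
  refine ENNReal.tsum_le_tsum fun i => ?_
  rw [← ENNReal.tsum_add]
  by_cases hi : i ∈ N
  · simp [hi]
  simp only [hi, not_false_iff, if_true, true_and]
  rcases H.row_cases i with h2 | ⟨s, h2, h3, -⟩
  · simp [h2.1]
  refine le_trans ?_ (ENNReal.le_tsum s)
  have hb := H.b_pos
  have hp := H.p_nonneg i s
  by_cases hs : h s < 2 * θ
  · rw [if_pos hs]
    refine le_trans (ENNReal.ofReal_le_ofReal ?_) le_add_self
    rw [h2, ← mul_div_assoc, le_div_iff₀ hb]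
    nlinarith [H.D_nonneg s]
  · have hsN : s ∈ N := (hN s).2 (by linarith)
    rw [if_pos hsN]
    refine le_trans (ENNReal.ofReal_le_ofReal ?_) le_self_add
    rw [h2]
    have h5 := mul_le_mul_of_nonneg_left (H.D_le s) (H.k_pos i).le
    nlinarith

theorem level_le (H : LevelData p h k e D r n0 b K) {θ : ℝ} (hθ : 0 < θ) (N : Set ℕ)
    (hN : ∀ j, j ∈ N ↔ θ ≤ h j) (hN' : ∀ j, j ∉ N → h j = k j) :
    ENNReal.ofReal θ * dsum (fun i j => i ∉ N ∧ j ∈ N) p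
        + ssum (fun i => i ∉ N) (fun i => k i * e i)
      ≤ dsum (fun i j => i ∈ N ∧ j ∉ N) (fun i j => p i j * h j)
        + ssum (fun j => h j < 2 * θ) (fun j => D j * h j / b) := by
  have h1 := H.balance_level N hN'
  have h2 := H.defect_le hθ N hN
  set Y := dsum (fun i j => i ∉ N ∧ j ∈ N) (fun i j => p i j * h j) with hY
  set Y' := dsum (fun i j => i ∉ N ∧ j ∈ N) (fun i j => p i j * (h j - θ)) with hY'
  have h3 : Y = ENNReal.ofReal θ * dsum (fun i j => i ∉ N ∧ j ∈ N) p + Y' := by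
    rw [← dsum_mul hθ.le, dsum_add]
    · exact dsum_congr (fun _ _ => Iff.rfl) fun i j _ => by ring
    · exact fun i j _ => mul_nonneg hθ.le (H.p_nonneg i j)
    · exact fun i j hij => mul_nonneg (H.p_nonneg i j) (by linarith [(hN j).1 hij.2])
  have h4 : Y' ≠ ∞ := by
    refine ne_top_of_le_ne_top (ssum_ne_top (c := fun _ => True) (fun i => (H.h_pos i).le)
      (H.k_summable.of_nonneg_of_le (fun i => (H.h_pos i).le) H.h_le)) ?_
    rw [← H.dsum_right (fun _ => True) h (fun j => (H.h_pos j).le)]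
    exact dsum_mono (fun _ _ _ => trivial)
      fun i j _ => mul_le_mul_of_nonneg_left (by linarith) (H.p_nonneg i j)
  refine (ENNReal.add_le_add_iff_right h4).1 ?_
  calc _ = Y + ssum (fun i => i ∉ N) (fun i => k i * e i) := by rw [h3]; ring
    _ ≤ _ := by rw [h1, add_assoc, add_comm (ssum (fun j => h j < 2 * θ) _)]; gcongr

theorem gap_le (H : LevelData p h k e D r n0 b K) {θ : ℝ} (hθ : 0 < θ) {N : Set ℕ}
    (hfin : N.Finite)
    (hN : ∀ j, j ∈ N ↔ θ ≤ h j) (hN' : ∀ j, j ∉ N → h j = k j) :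
    dsum (fun i j => i ∈ N ∧ j ∉ N) (fun i j => p i j * (θ - h j))
        + ssum (fun i => i ∉ N) (fun i => k i * e i)
      ≤ ssum (fun j => h j < 2 * θ) (fun j => D j * h j / b) := by
  have h1 := H.level_le hθ N hN hN'
  have h2 := H.crossing_le hfin
  set X := dsum (fun i j => i ∈ N ∧ j ∉ N) (fun i j => p i j * h j) with hX
  have h3 : ENNReal.ofReal θ * dsum (fun i j => i ∈ N ∧ j ∉ N) p
      = X + dsum (fun i j => i ∈ N ∧ j ∉ N) (fun i j => p i j * (θ - h j)) := by
    rw [← dsum_mul hθ.le, dsum_add]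
    · exact dsum_congr (fun _ _ => Iff.rfl) fun i j _ => by ring
    · exact fun i j _ => mul_nonneg (H.p_nonneg i j) (H.h_pos j).le
    · exact fun i j hij => mul_nonneg (H.p_nonneg i j)
        (by have := mt (hN j).2 hij.2; linarith)
  have h4 : X ≠ ∞ := by
    refine ne_top_of_le_ne_top (ssum_ne_top (c := fun _ => True) (fun i => (H.h_pos i).le)
      (H.k_summable.of_nonneg_of_le (fun i => (H.h_pos i).le) H.h_le)) ?_
    rw [← H.dsum_right (fun _ => True) h (fun j => (H.h_pos j).le)]
    exact dsum_mono (fun _ _ _ => trivial) fun i j _ => le_rfl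
  refine (ENNReal.add_le_add_iff_left h4).1 (le_trans ?_ h1)
  rw [← add_assoc, ← h3]
  gcongr

theorem lintegral_dsum {μ : Measure ℝ} (c : ℝ → ℕ → ℕ → Prop)
    [∀ u i j, Decidable (c u i j)] (f : ℝ → ℕ → ℕ → ℝ)
    (hc : ∀ i j, MeasurableSet {u | c u i j}) (hf : ∀ i j, Measurable fun u => f u i j) :
    ∫⁻ u, dsum (c u) (f u) ∂μ
      = ∑' i, ∑' j, ∫⁻ u, (if c u i j then ENNReal.ofReal (f u i j) else 0) ∂μ := by
  have h0 : ∀ u, dsum (c u) (f u) = ∑' i, ∑' j, if c u i j then ENNReal.ofReal (f u i j) else 0 :=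
    fun u => tsum_congr fun i => tsum_congr fun j => by congr
  simp only [h0]
  have h1 : ∀ i j, Measurable fun u => if c u i j then ENNReal.ofReal (f u i j) else 0 :=
    fun i j => Measurable.ite (hc i j) (hf i j).ennreal_ofReal measurable_const
  rw [lintegral_tsum fun i => (Measurable.tsum fun j => h1 i j).aemeasurable]
  refine tsum_congr fun i => ?_
  rw [lintegral_tsum fun j => (h1 i j).aemeasurable]

theorem lintegral_ssum {μ : Measure ℝ} (c : ℝ → ℕ → Prop) (f : ℕ → ℝ)
    (hc : ∀ i, MeasurableSet {u | c u i}) :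
    ∫⁻ u, ssum (c u) f ∂μ = ∑' i, ENNReal.ofReal (f i) * μ {u | c u i} := by
  unfold ssum
  have h1 : ∀ i, Measurable fun u => if c u i then ENNReal.ofReal (f i) else 0 :=
    fun i => Measurable.ite (hc i) measurable_const measurable_const
  rw [lintegral_tsum fun i => (h1 i).aemeasurable]
  refine tsum_congr fun i => ?_
  rw [← lintegral_indicator_const (hc i)]
  rfl

theorem row_transfer_le (H : LevelData p h k e D r n0 b K) {u₁ : ℝ} (hu₁ : 0 < u₁) (i : ℕ)
    (hi : 2 * u₁ < (k i)⁻¹) :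
    ∑' j, ∫⁻ u in Set.Ioi u₁,
        (if (k i)⁻¹ ≤ u ∧ u < (h j)⁻¹ then ENNReal.ofReal (p i j * h j) else 0)
      ≤ ENNReal.ofReal (14 + 6 * K) * ((∑' j, ∫⁻ u in Set.Ioi u₁,
        (if (k i)⁻¹ ≤ u ∧ u < (h j)⁻¹ then ENNReal.ofReal (p i j * (u⁻¹ - h j)) else 0))
        + ENNReal.ofReal (k i * e i) * volume.restrict (Set.Ioi u₁) {u | u < (k i)⁻¹}) := by
  have hk := H.k_pos i
  have he := H.e_nonneg i
  have hK := H.K_pos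
  have he12 : (12 : ℝ≥0∞) = ENNReal.ofReal 12 := (ENNReal.ofReal_ofNat 12).symm
  set A := (k i)⁻¹ with hA
  have hkA : k i * A = 1 := mul_inv_cancel₀ hk.ne'
  have hA0 : 0 < A := inv_pos.2 hk
  set G : ℕ → ℝ≥0∞ := fun j => ∫⁻ u in Set.Ioi u₁,
        (if A ≤ u ∧ u < (h j)⁻¹ then ENNReal.ofReal (p i j * (u⁻¹ - h j)) else 0) with hG
  have hq : ∀ j, ∫⁻ u in Set.Ioi u₁,
        (if A ≤ u ∧ u < (h j)⁻¹ then ENNReal.ofReal (p i j * h j) else 0)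
        ≤ ENNReal.ofReal (p i j * (1 - h j * A)) := by
    intro j
    have hm : MeasurableSet {u : ℝ | A ≤ u ∧ u < (h j)⁻¹} := measurableSet_Ico
    calc _ ≤ ∫⁻ u, (if A ≤ u ∧ u < (h j)⁻¹ then ENNReal.ofReal (p i j * h j) else 0) :=
          lintegral_mono' Measure.restrict_le_self le_rfl
      _ = ENNReal.ofReal (p i j * h j) * volume (Set.Ico A (h j)⁻¹) := by
          rw [← lintegral_indicator_const measurableSet_Ico]
          exact lintegral_congr fun u => by simp only [Set.indicator_apply, Set.mem_Ico]
      _ = _ := by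
          rw [Real.volume_Ico, ← ENNReal.ofReal_mul (mul_nonneg (H.p_nonneg i j) (H.h_pos j).le)]
          congr 1
          have := mul_inv_cancel₀ (H.h_pos j).ne'
          linear_combination (p i j) * this
  have hE : ENNReal.ofReal (e i) ≤ 2 * (ENNReal.ofReal (k i * e i)
      * volume.restrict (Set.Ioi u₁) {u | u < A}) := by
    rw [Measure.restrict_apply (s := Set.Ioi u₁) (t := {u | u < A}) measurableSet_Iio]
    have : {u | u < A} ∩ Set.Ioi u₁ = Set.Ioo u₁ A := by ext; simp [and_comm]
    rw [this, Real.volume_Ioo, ← ENNReal.ofReal_mul (by positivity),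
      ← ENNReal.ofReal_ofNat, ← ENNReal.ofReal_mul (by positivity)]
    refine ENNReal.ofReal_le_ofReal ?_
    have : k i * u₁ ≤ k i * A / 2 := by nlinarith
    nlinarith
  set E := ENNReal.ofReal (k i * e i) * volume.restrict (Set.Ioi u₁) {u | u < A}
  rw [mul_add]
  have hsumv : Summable fun j => p i j * h j := by
    obtain ⟨M, hM⟩ := H.k_summable.tendsto_atTop_zero.bddAbove_range
    refine Summable.of_nonneg_of_le (fun j => mul_nonneg (H.p_nonneg i j) (H.h_pos j).le)
      (fun j => ?_) ((H.row_summable i).mul_right M)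
    exact mul_le_mul_of_nonneg_left ((H.h_le j).trans (hM ⟨j, rfl⟩)) (H.p_nonneg i j)
  rcases H.row_cases i with ⟨-, h2⟩ | ⟨s, h2, h3, h4⟩
  · have h1 : ∑' j, ENNReal.ofReal (p i j * (1 - h j * A)) ≤ ENNReal.ofReal (K * e i) := by
      calc _ ≤ ∑' j, ENNReal.ofReal (p i j) := by
            refine ENNReal.tsum_le_tsum fun j => ENNReal.ofReal_le_ofReal ?_
            have := mul_pos (H.h_pos j) hA0
            nlinarith [H.p_nonneg i j]
        _ = ENNReal.ofReal (∑' j, p i j) :=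
            (ENNReal.ofReal_tsum_of_nonneg (H.p_nonneg i) (H.row_summable i)).symm
        _ ≤ _ := ENNReal.ofReal_le_ofReal ((H.row i).trans h2)
    refine (ENNReal.tsum_le_tsum hq).trans (h1.trans (le_trans ?_ le_add_self))
    rw [ENNReal.ofReal_mul hK.le]
    calc _ ≤ ENNReal.ofReal K * (2 * E) := by gcongr
      _ = ENNReal.ofReal (K * 2) * E := by
          rw [ENNReal.ofReal_mul hK.le, ENNReal.ofReal_ofNat, mul_assoc]
      _ ≤ _ := by gcongr; linarith
  · set P : ℕ → ℝ≥0∞ := fun j => if j = s then ENNReal.ofReal ((1 + K) * e i) else 0 with hP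
    set Q : ℕ → ℝ≥0∞ := fun j => if j = s then 0 else ENNReal.ofReal (2 * A * (p i j * h j))
      with hQ
    have hsub : (∑' j, p i j * h j) = k i * (1 + r i) - k i * e i := by rw [H.balance i]; ring
    have hps1 : p i s ≤ 1 :=
      ((H.row_summable i).le_tsum s fun j _ => H.p_nonneg i j).trans (H.row i)
    have hterm : ∀ j, ∫⁻ u in Set.Ioi u₁,
        (if A ≤ u ∧ u < (h j)⁻¹ then ENNReal.ofReal (p i j * h j) else 0)
        ≤ P j + (Q j + 12 * G j) := by
      intro j
      refine (hq j).trans ?_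
      by_cases hj : j = s
      · subst hj
        refine le_trans ?_ le_self_add
        simp only [hP, if_true]
        refine ENNReal.ofReal_le_ofReal ?_
        have hr := H.r_nonneg i
        rw [hsub] at h4
        have h5 : A * (k i * (1 + r i) - k i * e i - p i j * h j) ≤ A * (K * e i * k i) :=
          mul_le_mul_of_nonneg_left h4 hA0.le
        have h6 : A * (k i * (1 + r i) - k i * e i - p i j * h j)
          = (1 + r i) - e i - A * (p i j * h j) := by linear_combination (1 + r i - e i) * hkA
        have h7 : A * (K * e i * k i) = K * e i := by linear_combination (K * e i) * hkA
        rw [h6, h7] at h5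
        nlinarith
      · refine le_trans ?_ le_add_self
        by_cases hh : k i ≤ 2 * h j
        · refine le_trans ?_ le_self_add
          simp only [hQ, if_neg hj]
          refine ENNReal.ofReal_le_ofReal ?_
          have h8 : 1 ≤ 2 * A * h j := by
            have := mul_le_mul_of_nonneg_left hh hA0.le
            linarith
          have := mul_pos (H.h_pos j) hA0
          nlinarith [H.p_nonneg i j]
        · refine le_trans ?_ (le_add_self (a := 12 * G j) (b := Q j))
          have hB : 3 / 2 * A ≤ (h j)⁻¹ := by
            rw [le_inv_comm₀ (by positivity) (H.h_pos j), mul_inv, hA, inv_inv]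
            linarith
          have h9 : ENNReal.ofReal (p i j * (k i / 6)) * ENNReal.ofReal (A / 2) ≤ G j := by
            have hm : MeasurableSet (Set.Ico A (3 / 2 * A)) := measurableSet_Ico
            have : ENNReal.ofReal (A / 2)
                = volume.restrict (Set.Ioi u₁) (Set.Ico A (3 / 2 * A)) := by
              rw [Measure.restrict_apply hm, Set.inter_eq_left.2, Real.volume_Ico]
              · congr 1; ring
              · intro u hu
                have := hu.1
                simp only [Set.mem_Ioi]; linarith
            rw [this, ← lintegral_indicator_const hm]
            refine lintegral_mono fun u => ?_
            by_cases hu : u ∈ Set.Ico A (3 / 2 * A)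
            swap
            · rw [Set.indicator_of_notMem hu]; exact zero_le
            rw [Set.indicator_of_mem hu, if_pos ⟨hu.1, hu.2.trans_le hB⟩]
            refine ENNReal.ofReal_le_ofReal (mul_le_mul_of_nonneg_left ?_ (H.p_nonneg i j))
            have hu0 : 0 < u := hA0.trans_le hu.1
            have : 2 / 3 * k i ≤ u⁻¹ := by
              rw [le_inv_comm₀ (by positivity) hu0, mul_inv, ← hA]
              have := hu.2
              norm_num
              linarith
            linarith
          refine le_trans ?_ (mul_le_mul_right h9 12)
          rw [← ENNReal.ofReal_mul (by have := H.p_nonneg i j; positivity), he12,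
            ← ENNReal.ofReal_mul (by positivity)]
          refine ENNReal.ofReal_le_ofReal ?_
          have h10 : (12 : ℝ) * (p i j * (k i / 6) * (A / 2)) = p i j := by
            linear_combination (p i j) * hkA
          rw [h10]
          have := mul_pos (H.h_pos j) hA0
          nlinarith [H.p_nonneg i j]
    refine (ENNReal.tsum_le_tsum hterm).trans ?_
    rw [ENNReal.tsum_add, ENNReal.tsum_add, ENNReal.tsum_mul_left]
    have hPs : ∑' j, P j = ENNReal.ofReal ((1 + K) * e i) := by simp [hP]
    have hQs : ∑' j, Q j ≤ ENNReal.ofReal (2 * K * e i) := by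
      set f : ℕ → ℝ := fun j => if j = s then 0 else 2 * A * (p i j * h j) with hf
      have hf0 : ∀ j, 0 ≤ f j := fun j => by
        simp only [hf]; split_ifs
        · exact le_rfl
        · have := H.p_nonneg i j; have := H.h_pos j; positivity
      have hfs : HasSum f (2 * A * ((∑' j, p i j * h j) - p i s * h s)) := by
        have h11 := (hsumv.hasSum.mul_left (2 * A)).sub
          (hasSum_ite_eq s (2 * A * (p i s * h s)))
        rw [mul_sub]
        refine h11.congr_fun ?_
        intro j
        by_cases hj : j = s
        · subst hj; simp [hf]
        · simp [hf, hj]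
      have : ∑' j, Q j = ∑' j, ENNReal.ofReal (f j) := by
        refine tsum_congr fun j => ?_
        simp only [hQ, hf]; split_ifs <;> simp
      rw [this, ← ENNReal.ofReal_tsum_of_nonneg hf0 hfs.summable, hfs.tsum_eq]
      refine ENNReal.ofReal_le_ofReal ?_
      have := mul_le_mul_of_nonneg_left h4 hA0.le
      have h7 : A * (K * e i * k i) = K * e i := by linear_combination (K * e i) * hkA
      linarith
    have h12 : ENNReal.ofReal ((1 + K) * e i) + ENNReal.ofReal (2 * K * e i)
        ≤ ENNReal.ofReal (14 + 6 * K) * E := by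
      rw [← ENNReal.ofReal_add (by positivity) (by positivity)]
      calc _ = ENNReal.ofReal (1 + 3 * K) * ENNReal.ofReal (e i) := by
            rw [← ENNReal.ofReal_mul (by positivity)]; congr 1; ring
        _ ≤ ENNReal.ofReal (1 + 3 * K) * (2 * E) := by gcongr
        _ = ENNReal.ofReal ((1 + 3 * K) * 2) * E := by
          rw [ENNReal.ofReal_mul (by positivity), ENNReal.ofReal_ofNat, mul_assoc]
        _ ≤ _ := by gcongr; linarith
    have h13 : 12 * ∑' j, G j ≤ ENNReal.ofReal (14 + 6 * K) * ∑' j, G j := by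
      gcongr
      rw [he12]
      exact ENNReal.ofReal_le_ofReal (by linarith)
    rw [hPs, ← add_assoc, add_comm]
    refine add_le_add h13 (le_trans ?_ h12)
    gcongr

theorem row_transfer_le_one (H : LevelData p h k e D r n0 b K) (u₁ : ℝ) (i : ℕ) :
    ∑' j, ∫⁻ u in Set.Ioi u₁,
        (if (k i)⁻¹ ≤ u ∧ u < (h j)⁻¹ then ENNReal.ofReal (p i j * h j) else 0) ≤ 1 := by
  have hq : ∀ j, ∫⁻ u in Set.Ioi u₁,
      (if (k i)⁻¹ ≤ u ∧ u < (h j)⁻¹ then ENNReal.ofReal (p i j * h j) else 0)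
        ≤ ENNReal.ofReal (p i j) := by
    intro j
    calc _ ≤ ∫⁻ u, (if (k i)⁻¹ ≤ u ∧ u < (h j)⁻¹ then ENNReal.ofReal (p i j * h j) else 0) :=
          lintegral_mono' Measure.restrict_le_self le_rfl
      _ = ENNReal.ofReal (p i j * h j) * volume (Set.Ico (k i)⁻¹ (h j)⁻¹) := by
          rw [← lintegral_indicator_const measurableSet_Ico]
          exact lintegral_congr fun u => by simp only [Set.indicator_apply, Set.mem_Ico]
      _ ≤ _ := by
          have hp := mul_nonneg (H.p_nonneg i j) (H.h_pos j).le
          rw [Real.volume_Ico, ← ENNReal.ofReal_mul hp]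
          refine ENNReal.ofReal_le_ofReal ?_
          have := mul_inv_cancel₀ (H.h_pos j).ne'
          have h2 : p i j * h j * (h j)⁻¹ = p i j := by rw [mul_assoc, this, mul_one]
          have := mul_nonneg hp (inv_pos.2 (H.k_pos i)).le
          rw [mul_sub]; linarith
  refine (ENNReal.tsum_le_tsum hq).trans ?_
  rw [← ENNReal.ofReal_tsum_of_nonneg (H.p_nonneg i) (H.row_summable i)]
  exact ENNReal.ofReal_le_one.2 (H.row i)

/-- The level sets `N u`. -/
def lev (k : ℕ → ℝ) (u : ℝ) : Set ℕ := {i | (k i)⁻¹ ≤ u}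

theorem finite_lev (H : LevelData p h k e D r n0 b K) (u : ℝ) : (lev k u).Finite := by
  have h1 : Tendsto (fun i => (k i)⁻¹) atTop atTop :=
    tendsto_inv_nhdsGT_zero.comp (tendsto_nhdsWithin_iff.2
      ⟨H.k_summable.tendsto_atTop_zero, Eventually.of_forall H.k_pos⟩)
  have h2 := h1.eventually_gt_atTop u
  rw [← Nat.cofinite_eq_atTop] at h2
  refine h2.subset fun i hi => ?_
  simpa [lev] using hi

theorem exists_start (h : ℕ → ℝ) (n0 : ℕ) : ∃ u₁ : ℝ, 0 < u₁ ∧ ∀ j, j < n0 → (h j)⁻¹ ≤ u₁ := by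
  refine ⟨1 + ∑ j ∈ Finset.range n0, |(h j)⁻¹|, ?_, fun j hj => ?_⟩
  · have := Finset.sum_nonneg (s := Finset.range n0) (f := fun j => |(h j)⁻¹|)
      (fun j _ => abs_nonneg _)
    linarith
  · have := Finset.single_le_sum (s := Finset.range n0) (f := fun j => |(h j)⁻¹|)
      (fun j _ => abs_nonneg _) (Finset.mem_range.2 hj)
    have := le_abs_self (h j)⁻¹
    linarith

theorem mem_lev (H : LevelData p h k e D r n0 b K) {u₁ u : ℝ}
    (hu : ∀ j, j < n0 → (h j)⁻¹ ≤ u₁) (huu : u₁ < u) (j : ℕ) :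
    (j ∈ lev k u ↔ (h j)⁻¹ ≤ u) ∧ (j ∉ lev k u → h j = k j) := by
  by_cases hj : j < n0
  · have h1 := hu j hj
    have h2 : (k j)⁻¹ ≤ (h j)⁻¹ := inv_anti₀ (H.h_pos j) (H.h_le j)
    have h3 : j ∈ lev k u := by simp only [lev, Set.mem_ofPred_eq]; linarith
    exact ⟨⟨fun _ => by linarith, fun _ => h3⟩, fun hn => absurd h3 hn⟩
  · have := H.h_eq j (not_lt.1 hj)
    rw [this]
    exact ⟨Iff.rfl, fun _ => rfl⟩

theorem lintegral_flow_ne_top (H : LevelData p h k e D r n0 b K) {u₁ : ℝ} (hu₀ : 0 < u₁)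
    (hu : ∀ j, j < n0 → (h j)⁻¹ ≤ u₁) :
    ∫⁻ u in Set.Ioi u₁, ENNReal.ofReal u⁻¹ * dsum (fun i j => i ∉ lev k u ∧ j ∈ lev k u) p
      ≠ ∞ := by
  have hm : ∀ x : ℝ, MeasurableSet {u : ℝ | x ≤ u} := fun x => measurableSet_Ici
  have hm' : ∀ x : ℝ, MeasurableSet {u : ℝ | u < x} := fun x => measurableSet_Iio
  set R : ℝ → ℝ≥0∞ := fun u => ssum (fun j => u < 2 * (h j)⁻¹) (fun j => D j * h j / b) with hR
  have hR_int : ∫⁻ u in Set.Ioi u₁, R u ≠ ∞ := by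
    rw [hR, lintegral_ssum _ _ (fun i => hm' _)]
    have h1 : ∀ j, ENNReal.ofReal (D j * h j / b)
        * volume.restrict (Set.Ioi u₁) {u | u < 2 * (h j)⁻¹} ≤ ENNReal.ofReal (2 / b * D j) := by
      intro j
      rw [Measure.restrict_apply (hm' _)]
      have h2 : {u | u < 2 * (h j)⁻¹} ∩ Set.Ioi u₁ ⊆ Set.Ioo 0 (2 * (h j)⁻¹) :=
        fun u hu => ⟨hu₀.trans hu.2, hu.1⟩
      refine (mul_le_mul_right (measure_mono h2) _).trans ?_
      have h3 : 0 ≤ D j * h j / b :=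
        div_nonneg (mul_nonneg (H.D_nonneg j) (H.h_pos j).le) H.b_pos.le
      rw [Real.volume_Ioo, ← ENNReal.ofReal_mul h3]
      refine ENNReal.ofReal_le_ofReal (le_of_eq ?_)
      have := H.h_pos j
      field_simp
      ring
    refine ne_top_of_le_ne_top ?_ (ENNReal.tsum_le_tsum h1)
    rw [← ENNReal.ofReal_tsum_of_nonneg _ (H.D_summable.mul_left _)]
    · exact ENNReal.ofReal_ne_top
    · exact fun j => mul_nonneg (div_nonneg (by norm_num) H.b_pos.le) (H.D_nonneg j)
  set X : ℝ → ℝ≥0∞ := fun u =>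
    dsum (fun i j => (k i)⁻¹ ≤ u ∧ u < (h j)⁻¹) (fun i j => p i j * h j) with hX
  set G : ℝ → ℝ≥0∞ := fun u =>
    dsum (fun i j => (k i)⁻¹ ≤ u ∧ u < (h j)⁻¹) (fun i j => p i j * (u⁻¹ - h j)) with hG
  set E : ℝ → ℝ≥0∞ := fun u => ssum (fun i => u < (k i)⁻¹) (fun i => k i * e i) with hE
  have hpt : ∀ u ∈ Set.Ioi u₁,
      ENNReal.ofReal u⁻¹ * dsum (fun i j => i ∉ lev k u ∧ j ∈ lev k u) p ≤ X u + R u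
      ∧ G u + E u ≤ R u := by
    intro u huu
    have hu0 : 0 < u := hu₀.trans huu
    have hmem := H.mem_lev hu huu
    have hN : ∀ j, j ∈ lev k u ↔ u⁻¹ ≤ h j := fun j => by
      rw [(hmem j).1, inv_le_comm₀ hu0 (H.h_pos j)]
    have hc : ∀ i j, (i ∈ lev k u ∧ j ∉ lev k u) ↔ ((k i)⁻¹ ≤ u ∧ u < (h j)⁻¹) := fun i j => by
      rw [(hmem j).1, not_le]; rfl
    have hr : ∀ j, h j < 2 * u⁻¹ ↔ u < 2 * (h j)⁻¹ := fun j => by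
      rw [← div_eq_mul_inv, ← div_eq_mul_inv, lt_div_iff₀ hu0, lt_div_iff₀ (H.h_pos j), mul_comm]
    have h1 := H.level_le (inv_pos.2 hu0) (lev k u) hN (fun j => (hmem j).2)
    have h2 := H.gap_le (inv_pos.2 hu0) (H.finite_lev u) hN (fun j => (hmem j).2)
    rw [dsum_congr hc (fun _ _ _ => rfl), ssum_congr hr (fun _ _ => rfl)] at h1 h2
    have h3 : ∀ i, (i ∉ lev k u) ↔ u < (k i)⁻¹ := fun i => by simp [lev]
    rw [ssum_congr h3 (fun _ _ => rfl)] at h1 h2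
    exact ⟨le_self_add.trans h1, h2⟩
  have hmc : ∀ i j, MeasurableSet {u : ℝ | (k i)⁻¹ ≤ u ∧ u < (h j)⁻¹} :=
    fun i j => (hm _).inter (hm' _)
  have hGE : ∫⁻ u in Set.Ioi u₁, (G u + E u) ≤ ∫⁻ u in Set.Ioi u₁, R u :=
    setLIntegral_mono' measurableSet_Ioi fun u hu => (hpt u hu).2
  have hEm : Measurable E := by
    rw [hE]; unfold ssum
    exact Measurable.tsum fun i => Measurable.ite (hm' _) measurable_const measurable_const
  have hRm : Measurable R := by
    rw [hR]; unfold ssum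
    exact Measurable.tsum fun i => Measurable.ite (hm' _) measurable_const measurable_const
  rw [lintegral_add_right _ hEm, hG, hE, lintegral_dsum _ _ hmc (fun i j => by fun_prop),
    lintegral_ssum _ _ (fun i => hm' _), ← ENNReal.tsum_add] at hGE
  have hXint : ∫⁻ u in Set.Ioi u₁, X u ≠ ∞ := by
    rw [hX, lintegral_dsum _ _ hmc (fun i j => by fun_prop)]
    have hfin := H.finite_lev (2 * u₁)
    have hrow : ∀ i, (∑' j, ∫⁻ u in Set.Ioi u₁,
        (if (k i)⁻¹ ≤ u ∧ u < (h j)⁻¹ then ENNReal.ofReal (p i j * h j) else 0))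
        ≤ (if i ∈ lev k (2 * u₁) then 1 else 0) + ENNReal.ofReal (14 + 6 * K) *
        ((∑' j, ∫⁻ u in Set.Ioi u₁,
        (if (k i)⁻¹ ≤ u ∧ u < (h j)⁻¹ then ENNReal.ofReal (p i j * (u⁻¹ - h j)) else 0))
        + ENNReal.ofReal (k i * e i) * volume.restrict (Set.Ioi u₁) {u | u < (k i)⁻¹}) := by
      intro i
      by_cases hi : i ∈ lev k (2 * u₁)
      · rw [if_pos hi]
        exact (H.row_transfer_le_one u₁ i).trans le_self_add
      · rw [if_neg hi, zero_add]
        exact H.row_transfer_le hu₀ i (not_le.1 hi)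
    refine ne_top_of_le_ne_top ?_ (ENNReal.tsum_le_tsum hrow)
    rw [ENNReal.tsum_add, ENNReal.tsum_mul_left]
    refine ENNReal.add_ne_top.2 ⟨?_, ENNReal.mul_ne_top ENNReal.ofReal_ne_top
      (ne_top_of_le_ne_top hR_int hGE)⟩
    rw [tsum_eq_sum (s := hfin.toFinset)]
    · refine ENNReal.sum_ne_top.2 fun i _ => ?_
      split_ifs <;> simp
    · intro i hi
      rw [Set.Finite.mem_toFinset] at hi
      simp [hi]
  refine ne_top_of_le_ne_top ?_ (setLIntegral_mono' measurableSet_Ioi fun u hu => (hpt u hu).1)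
  rw [lintegral_add_right _ hRm]
  exact ENNReal.add_ne_top.2 ⟨hXint, hR_int⟩

/-- There are arbitrarily large finite sets of indices with arbitrarily small outgoing flow. -/
theorem exists_small_flow (H : LevelData p h k e D r n0 b K) {η : ℝ} (hη : 0 < η)
    (n1 : ℕ) : ∃ N : Finset ℕ, Finset.range n1 ⊆ N ∧
      dsum (fun i j => i ∉ N ∧ j ∈ N) p ≤ ENNReal.ofReal η := by
  obtain ⟨u₁, hu₀, hu⟩ := exists_start h n0
  obtain ⟨u₂, hu₂, hu₂'⟩ := exists_start k n1
  by_contra! hcon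
  have h1 : ∀ u ∈ Set.Ioi (max u₁ u₂),
      ENNReal.ofReal η * ENNReal.ofReal u⁻¹ ≤
      ENNReal.ofReal u⁻¹ * dsum (fun i j => i ∉ lev k u ∧ j ∈ lev k u) p := by
    intro u huu
    have h2 := hcon (H.finite_lev u).toFinset (fun j hj => by
      rw [Set.Finite.mem_toFinset]
      exact (hu₂' j (Finset.mem_range.1 hj)).trans ((le_max_right _ _).trans huu.le))
    rw [mul_comm]
    refine mul_le_mul_right (h2.le.trans (le_of_eq ?_)) _
    exact dsum_congr (fun i j => by simp) fun _ _ _ => rfl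
  have h3 : ∫⁻ u in Set.Ioi (max u₁ u₂), ENNReal.ofReal η * ENNReal.ofReal u⁻¹ ≠ ∞ := by
    refine ne_top_of_le_ne_top (H.lintegral_flow_ne_top hu₀ hu)
      ((setLIntegral_mono' measurableSet_Ioi h1).trans ?_)
    exact lintegral_mono_set (Set.Ioi_subset_Ioi (le_max_left _ _))
  rw [lintegral_const_mul _ (by fun_prop)] at h3
  have h4 : ∫⁻ u in Set.Ioi (max u₁ u₂), ENNReal.ofReal u⁻¹ ≠ ∞ := by
    intro h5
    rw [h5, ENNReal.mul_top (by simpa using hη)] at h3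
    exact h3 rfl
  refine not_integrableOn_Ioi_inv (a := max u₁ u₂) ⟨by fun_prop, ?_⟩
  rw [hasFiniteIntegral_iff_ofReal]
  · exact lt_top_iff_ne_top.2 h4
  · refine (ae_restrict_iff' measurableSet_Ioi).2 (Eventually.of_forall fun u hu => ?_)
    exact inv_nonneg.2 (hu₀.le.trans ((le_max_left _ _).trans (le_of_lt hu)))

end LevelData
end Levels

section CubeMeasure
open MeasureTheory
open scoped Classical ENNReal

/-- Lebesgue measure on the unit interval. -/
def unitMeasure : Measure ℝ := volume.restrict (Set.Icc 0 1)

instance : IsProbabilityMeasure unitMeasure :=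
  ⟨by simp [unitMeasure]⟩

/-- The product measure on the Hilbert cube. -/
def cubeMeasure : Measure (ℕ → ℝ) := Measure.infinitePi fun _ => unitMeasure

instance : IsProbabilityMeasure cubeMeasure :=
  inferInstanceAs (IsProbabilityMeasure (Measure.infinitePi fun _ : ℕ => unitMeasure))

theorem measurableSet_cube : MeasurableSet cube := by
  have : cube = ⋂ i, (fun x : ℕ → ℝ => x i) ⁻¹' Set.Icc 0 1 := by ext; simp [cube]
  rw [this]
  exact MeasurableSet.iInter fun i => measurable_pi_apply i measurableSet_Icc

theorem cubeMeasure_cube : cubeMeasure cube = 1 := by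
  have : cube = Set.univ.pi fun _ => Set.Icc (0 : ℝ) 1 := by
    ext; simp only [cube, Set.mem_ofPred_eq, Set.mem_univ_pi]
  rw [this, cubeMeasure, Measure.infinitePi_pi_univ _ fun _ => measurableSet_Icc]
  simp [unitMeasure]

theorem ae_mem_cube : ∀ᵐ x ∂cubeMeasure, x ∈ cube :=
  (prob_compl_eq_zero_iff measurableSet_cube).2 cubeMeasure_cube

/-- The sequence which agrees with `z.2` on `S` and with `z.1` off `S`. -/
def glue (S : Set ℕ) (z : (ℕ → ℝ) × (ℕ → ℝ)) : ℕ → ℝ := fun i => if i ∈ S then z.2 i else z.1 i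

theorem measurePreserving_glue (S : Set ℕ) :
    MeasurePreserving (glue S) (cubeMeasure.prod cubeMeasure) cubeMeasure := by
  have hm : Measurable (glue S) := by
    refine measurable_pi_lambda _ fun i => ?_
    unfold glue
    split_ifs <;> fun_prop
  refine ⟨hm, ?_⟩
  refine Measure.eq_infinitePi _ fun s t ht => ?_
  rw [Measure.map_apply hm (MeasurableSet.pi s.countable_toSet fun i _ => ht i)]
  have h1 : glue S ⁻¹' Set.pi s t
      = (Set.pi (s.filter fun i => i ∉ S) t) ×ˢ (Set.pi (s.filter fun i => i ∈ S) t) := by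
    ext z
    simp only [Set.mem_preimage, Set.mem_pi, glue, Set.mem_prod, Finset.coe_filter,
      Set.mem_ofPred_eq, SetLike.mem_coe]
    constructor
    · intro h
      exact ⟨fun i hi => by simpa [hi.2] using h i hi.1, fun i hi => by simpa [hi.2] using h i hi.1⟩
    · rintro ⟨h, h'⟩ i hi
      by_cases hS : i ∈ S
      · simpa [hS] using h' i ⟨hi, hS⟩
      · simpa [hS] using h i ⟨hi, hS⟩
  rw [h1, Measure.prod_prod, cubeMeasure, Measure.infinitePi_pi _ (fun i _ => ht i),
    Measure.infinitePi_pi _ (fun i _ => ht i), mul_comm, Finset.prod_filter_mul_prod_filter_not]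

/-- The reflection of the cube in its centre preserves the measure. -/
theorem measurePreserving_reflect :
    MeasurePreserving (fun (x : ℕ → ℝ) i => 1 - x i) cubeMeasure cubeMeasure := by
  refine ⟨by fun_prop, ?_⟩
  have h1 : unitMeasure.map (fun x => 1 - x) = unitMeasure := by
    have h2 : MeasurePreserving (fun x : ℝ => 1 - x) volume volume :=
      Measure.measurePreserving_sub_left volume 1
    have h3 := h2.restrict_preimage (s := Set.Icc 0 1) measurableSet_Icc
    have h4 : (fun x : ℝ => 1 - x) ⁻¹' Set.Icc 0 1 = Set.Icc 0 1 := by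
      ext x; simp only [Set.mem_preimage, Set.mem_Icc]; constructor <;> intro h <;>
        constructor <;> linarith [h.1, h.2]
    rw [h4] at h3
    exact h3.map_eq
  unfold cubeMeasure
  rw [Measure.infinitePi_map_pi (f := fun _ x => 1 - x) _ (fun i => by fun_prop)]
  simp only [h1]

end CubeMeasure

section Determinant
open MeasureTheory
open scoped Classical ENNReal

theorem one_sub_sum_le_prod_one_sub {ι : Type*} (s : Finset ι) (f : ι → ℝ)
    (h0 : ∀ i ∈ s, 0 ≤ f i) (h1 : ∀ i ∈ s, f i ≤ 1) :
    1 - ∑ i ∈ s, f i ≤ ∏ i ∈ s, (1 - f i) := by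
  induction s using Finset.induction_on with
  | empty => simp
  | insert a s ha ih =>
    rw [Finset.sum_insert ha, Finset.prod_insert ha]
    have h2 := ih (fun i hi => h0 i (Finset.mem_insert_of_mem hi))
      (fun i hi => h1 i (Finset.mem_insert_of_mem hi))
    have h3 := h0 a (Finset.mem_insert_self _ _)
    have h4 := h1 a (Finset.mem_insert_self _ _)
    have h5 := Finset.sum_nonneg fun i hi => h0 i (Finset.mem_insert_of_mem (b := a) hi)
    nlinarith

theorem Matrix.one_sub_trace_le_det_gram {n : Type*} [Fintype n] [DecidableEq n]
    (M : Matrix n n ℝ) (hM : ∀ x : n → ℝ, ∑ i, (M.mulVec x i) ^ 2 ≤ ∑ i, (x i) ^ 2) :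
    1 - ∑ j, (1 - ∑ i, (M i j) ^ 2) ≤ M.det ^ 2 := by
  set A := M.transpose * M with hA
  have hH : A.IsHermitian := by
    rw [hA, ← Matrix.conjTranspose_eq_transpose_of_trivial]
    exact Matrix.isHermitian_conjTranspose_mul_self M
  have hdet : A.det = M.det ^ 2 := by rw [hA, Matrix.det_mul, Matrix.det_transpose, sq]
  have htr : A.trace = ∑ j, ∑ i, (M i j) ^ 2 := by
    simp [hA, Matrix.trace, Matrix.mul_apply, sq]
  have key : ∀ v : n → ℝ, ∑ i, (M.mulVec v i) ^ 2 = v ⬝ᵥ A.mulVec v := by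
    intro v
    rw [hA, ← Matrix.mulVec_mulVec, Matrix.dotProduct_mulVec, Matrix.vecMul_transpose]
    simp [dotProduct, sq]
  have heig : ∀ i, 0 ≤ hH.eigenvalues i ∧ hH.eigenvalues i ≤ 1 := by
    intro i
    set v : n → ℝ := (hH.eigenvectorBasis i).ofLp with hv
    have h1 : A.mulVec v = hH.eigenvalues i • v := hH.mulVec_eigenvectorBasis i
    have h2 := key v
    rw [h1, dotProduct_smul, smul_eq_mul] at h2
    have h3 : v ⬝ᵥ v = 1 := by
      have h4 := hH.eigenvectorBasis.orthonormal.1 i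
      have h5 := EuclideanSpace.real_norm_sq_eq (hH.eigenvectorBasis i)
      rw [h4] at h5
      simp only [dotProduct, hv, ← sq]
      linarith
    have h6 : ∑ j, (v j) ^ 2 = 1 := by rw [← h3]; simp [dotProduct, sq]
    have h7 := hM v
    rw [h2, h3, h6, mul_one] at h7
    rw [h3, mul_one] at h2
    exact ⟨h2 ▸ Finset.sum_nonneg fun j _ => sq_nonneg _, h7⟩
  have h1 : A.det = ∏ i, hH.eigenvalues i := by simpa using hH.det_eq_prod_eigenvalues
  have h2 : A.trace = ∑ i, hH.eigenvalues i := by simpa using hH.trace_eq_sum_eigenvalues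
  have h3 : 1 - ∑ i, (1 - hH.eigenvalues i) ≤ ∏ i, (1 - (1 - hH.eigenvalues i)) :=
    one_sub_sum_le_prod_one_sub _ _ (fun i _ => by linarith [(heig i).2])
      (fun i _ => by linarith [(heig i).1])
  simp only [sub_sub_cancel] at h3
  rw [← hdet, h1]
  refine le_trans (le_of_eq ?_) h3
  rw [Finset.sum_sub_distrib, Finset.sum_sub_distrib, ← h2, htr]

theorem cubeMeasure_mul_det_le {A : ℕ → ℕ → ℝ} (hA : ∀ i, Summable fun j => |A i j|)
    {c lo hi : ℕ → ℝ} (hlh : ∀ i, lo i ≤ hi i) {B : Set (ℕ → ℝ)} (hBm : MeasurableSet B)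
    (hBc : B ⊆ cube)
    (hB : ∀ x ∈ B, ∀ i, c i + ∑' j, A i j * x j ∈ Set.Icc (lo i) (hi i)) (N : Finset ℕ) :
    cubeMeasure B * ENNReal.ofReal |(Matrix.of fun i j : N => A i j).det|
      ≤ ENNReal.ofReal (∏ i ∈ N, (hi i - lo i)) := by
  set M : Matrix N N ℝ := Matrix.of fun i j : N => A i j with hM
  by_cases hdet : M.det = 0
  · simp [hdet]
  have hsec : ∀ x : ℕ → ℝ, cubeMeasure {y | glue N (x, y) ∈ B}
      ≤ ENNReal.ofReal |(M.det)⁻¹| * ENNReal.ofReal (∏ i ∈ N, (hi i - lo i)) := by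
    intro x
    set d : ℕ → ℝ := fun i => c i + ∑' j, A i j * (if j ∈ N then 0 else x j) with hd
    set S : Set (N → ℝ) := (Matrix.toLin' M) ⁻¹'
      (Set.Icc (fun i => lo i - d i) (fun i => hi i - d i)) with hS
    have hSm : MeasurableSet S :=
      (LinearMap.continuous_of_finiteDimensional (Matrix.toLin' M)).measurable measurableSet_Icc
    have h1 : {y | glue N (x, y) ∈ B} ⊆ N.restrict ⁻¹' S := by
      intro y hy
      have hz := hBc hy
      have hzs : ∀ i, Summable fun j => A i j * glue N (x, y) j := by
        intro i
        refine Summable.of_norm_bounded (hA i) fun j => ?_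
        rw [Real.norm_eq_abs, abs_mul]
        refine mul_le_of_le_one_right (abs_nonneg _) (abs_le.2 ⟨?_, (hz j).2⟩)
        linarith [(hz j).1]
      have hval : ∀ i : N, c i + ∑' j, A i j * glue N (x, y) j
          = M.mulVec (fun j : N => y j) i + d i := by
        intro i
        have h2 : HasSum (fun j => if j ∈ N then A i j * y j else 0) (∑ j ∈ N, A i j * y j) := by
          have : HasSum (fun j => if j ∈ N then A i j * y j else 0)
              (∑ j ∈ N, if j ∈ N then A i j * y j else 0) :=
            hasSum_sum_of_ne_finset_zero (fun j hj => if_neg hj)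
          convert this using 1
          exact Finset.sum_congr rfl fun j hj => by simp [hj]
        have h3 := (hzs i).hasSum.sub h2
        have h4 : (fun j => A i j * glue N (x, y) j - if j ∈ N then A i j * y j else 0)
            = fun j => A i j * (if j ∈ N then 0 else x j) := by
          funext j
          by_cases hj : j ∈ N <;> simp [glue, hj]
        rw [h4] at h3
        rw [hd]
        simp only
        rw [h3.tsum_eq]
        have h5 : M.mulVec (fun j : N => y j) i = ∑ j ∈ N, A i j * y j := by
          rw [← Finset.sum_coe_sort N (fun j => A i j * y j)]
          rfl
        rw [h5]; ring
      have h6 := hB _ hy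
      rw [Set.mem_preimage, hS, Set.mem_preimage, Matrix.toLin'_apply]
      have h7 : ∀ i : N, M.mulVec (fun j : N => y j) i + d i ∈ Set.Icc (lo i) (hi i) :=
        fun i => hval i ▸ h6 i
      constructor
      · intro i
        have := (h7 i).1
        change lo i - d i ≤ M.mulVec (fun j : N => y j) i
        linarith
      · intro i
        have := (h7 i).2
        change M.mulVec (fun j : N => y j) i ≤ hi i - d i
        linarith
    calc _ ≤ cubeMeasure (N.restrict ⁻¹' S) := measure_mono h1
      _ = Measure.pi (fun _ : N => unitMeasure) S := by
          rw [← Measure.infinitePi_map_restrict (fun _ : ℕ => unitMeasure) (I := N),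
            Measure.map_apply (Finset.measurable_restrict N) hSm]
          rfl
      _ ≤ volume S := by
          unfold unitMeasure
          rw [← Measure.restrict_pi_pi]
          exact Measure.restrict_apply_le _ _
      _ = _ := by
          have hdet' : LinearMap.det (Matrix.toLin' M) ≠ 0 := by rwa [LinearMap.det_toLin']
          rw [hS, Measure.addHaar_preimage_linearMap _ hdet', LinearMap.det_toLin',
            Real.volume_Icc_pi, ← ENNReal.ofReal_prod_of_nonneg]
          · congr 2
            rw [← Finset.prod_coe_sort N]
            exact Finset.prod_congr rfl fun i _ => by ring
          · exact fun i _ => by simp only [sub_sub_sub_cancel_right, sub_nonneg]; exact hlh i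
  have htot : cubeMeasure B
      ≤ ENNReal.ofReal |(M.det)⁻¹| * ENNReal.ofReal (∏ i ∈ N, (hi i - lo i)) := by
    rw [← (measurePreserving_glue N).measure_preimage hBm.nullMeasurableSet,
      Measure.prod_apply ((measurePreserving_glue N).measurable hBm)]
    calc _ ≤ ∫⁻ _x, _ ∂cubeMeasure := lintegral_mono fun x => hsec x
      _ = _ := by simp
  calc _ ≤ _ := mul_le_mul_left htot _
    _ = ENNReal.ofReal (|(M.det)⁻¹| * |M.det|) * ENNReal.ofReal (∏ i ∈ N, (hi i - lo i)) := by
        rw [ENNReal.ofReal_mul (abs_nonneg _)]; ring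
    _ = _ := by
        rw [← abs_mul, inv_mul_cancel₀ hdet]; simp

end Determinant

section Isometry
open MeasureTheory
open scoped Classical ENNReal Topology

/-- The space `ℓ²`. -/
abbrev Ell : Type := lp (fun _ : ℕ => ℝ) 2

/-- The isometric embedding of the Hilbert cube in `ℓ²`. -/
def emb (a y : ℕ → ℝ) : Ell :=
  if h : Memℓp (fun i => a i * y i) 2 then ⟨fun i => a i * y i, h⟩ else 0

theorem memℓp_two_iff {u : ℕ → ℝ} : Memℓp u 2 ↔ Summable fun i => (u i) ^ 2 := by
  rw [memℓp_gen_iff (by norm_num)]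
  simp

theorem emb_apply {a y : ℕ → ℝ} (hsum : Summable fun i => (a i) ^ 2) (hy : y ∈ cube) (i : ℕ) :
    emb a y i = a i * y i := by
  have h : Memℓp (fun i => a i * y i) 2 := by
    rw [memℓp_two_iff]
    refine Summable.of_nonneg_of_le (fun i => sq_nonneg _) (fun i => ?_) hsum
    rw [mul_pow]
    have h1 : y i ^ 2 ≤ 1 := by nlinarith [(hy i).1, (hy i).2]
    nlinarith [sq_nonneg (a i)]
  rw [emb, dif_pos h]

theorem Ell.norm_sq (u : Ell) : HasSum (fun i => (u i) ^ 2) (‖u‖ ^ 2) := by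
  have h := lp.hasSum_norm (p := 2) (by norm_num) u
  simpa using h

theorem Ell.inner_hasSum (u v : Ell) : HasSum (fun i => u i * v i) (inner ℝ u v) := by
  have h := lp.hasSum_inner (𝕜 := ℝ) u v
  simpa [mul_comm] using h

theorem norm_emb_sub {a y z : ℕ → ℝ} (hsum : Summable fun i => (a i) ^ 2) (hy : y ∈ cube)
    (hz : z ∈ cube) : ‖emb a y - emb a z‖ = da a y z := by
  have h := Ell.norm_sq (emb a y - emb a z)
  have h1 : (fun i => ((emb a y - emb a z) i) ^ 2) = fun i => (a i) ^ 2 * (y i - z i) ^ 2 := by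
    funext i
    rw [lp.coeFn_sub, Pi.sub_apply, emb_apply hsum hy, emb_apply hsum hz]; ring
  rw [h1] at h
  rw [da, h.tsum_eq, Real.sqrt_sq (norm_nonneg _)]

theorem continuousOn_emb {a : ℕ → ℝ} (hsum : Summable fun i => (a i) ^ 2) {x : ℕ → ℝ}
    (hx : x ∈ cube) : ContinuousOn (fun y => da a y x) cube := by
  unfold da
  refine Real.continuous_sqrt.comp_continuousOn ?_
  refine continuousOn_tsum (fun i => by fun_prop) hsum fun i y hy => ?_
  rw [Real.norm_eq_abs, abs_of_nonneg (by positivity)]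
  have h1 : (y i - x i) ^ 2 ≤ 1 := by nlinarith [(hy i).1, (hy i).2, (hx i).1, (hx i).2]
  nlinarith [sq_nonneg (a i)]

theorem mul_abs_sub_le_of_isIsomOn {a : ℕ → ℝ} (ha : ∀ i, 0 < a i)
    (hsum : Summable fun i => (a i) ^ 2) {f : (ℕ → ℝ) → ℕ → ℝ} {J : Set (ℕ → ℝ)} (hJ : J ⊆ cube)
    (hf : IsIsomOn a f J) {x y : ℕ → ℝ} (hx : x ∈ J) (hy : y ∈ J) (i : ℕ) :
    a i * |f x i - f y i| ≤ da a x y := by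
  by_cases hxy : x = y
  · subst hxy; simp [da]
  have hpos : 0 < da a x y := by
    rw [← norm_emb_sub hsum (hJ hx) (hJ hy), norm_sub_pos_iff]
    intro h
    refine hxy (funext fun j => ?_)
    have h1 := emb_apply hsum (hJ hx) j
    rw [h, emb_apply hsum (hJ hy)] at h1
    exact (mul_left_cancel₀ (ha j).ne' h1).symm
  rw [← hf x hx y hy] at hpos ⊢
  have hs : Summable fun i => (a i) ^ 2 * (f x i - f y i) ^ 2 := by
    by_contra hns
    rw [da, tsum_eq_zero_of_not_summable hns] at hpos
    simp at hpos
  have h1 := hs.le_tsum i fun j _ => by positivity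
  rw [da]
  refine Real.le_sqrt_of_sq_le ?_
  rw [mul_pow, sq_abs]
  exact h1

theorem isClosed_image {a : ℕ → ℝ} (ha : ∀ i, 0 < a i)
    (hsum : Summable fun i => (a i) ^ 2) {f : (ℕ → ℝ) → ℕ → ℝ} {J : Set (ℕ → ℝ)} (hJ : J ⊆ cube)
    (hJc : IsCompact J) (hf : IsIsomOn a f J) : IsClosed (f '' J) := by
  refine (hJc.image_of_continuousOn (continuousOn_pi.2 fun i x hx => ?_)).isClosed
  have h1 : Tendsto (fun y => da a y x) (𝓝[J] x) (𝓝 (da a x x)) :=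
    (continuousOn_emb hsum (hJ hx)).mono hJ x hx
  have h2 : da a x x = 0 := by simp [da]
  rw [h2] at h1
  have h3 := h1.const_mul (a i)⁻¹
  rw [mul_zero] at h3
  rw [ContinuousWithinAt, tendsto_iff_dist_tendsto_zero]
  refine squeeze_zero' (Eventually.of_forall fun y => dist_nonneg) ?_ h3
  filter_upwards [self_mem_nhdsWithin] with y hy
  have h4 := mul_abs_sub_le_of_isIsomOn ha hsum hJ hf hy hx i
  rw [Real.dist_eq, ← mul_le_mul_iff_right₀ (ha i), ← mul_assoc, mul_inv_cancel₀ (ha i).ne',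
    one_mul]
  exact h4

theorem isCompact_cylSet (lo hi : ℕ → ℝ) : IsCompact (cylSet lo hi) := by
  have : cylSet lo hi = Set.univ.pi fun i => Set.Icc (lo i) (hi i) := by
    ext; simp only [cylSet, Set.mem_ofPred_eq, Set.mem_univ_pi]
  rw [this]
  exact isCompact_univ_pi fun i => isCompact_Icc

/-- A set of positive measure contains two points which differ in a given coordinate only. -/
theorem exists_pair {B : Set (ℕ → ℝ)} (hBm : MeasurableSet B) (hB : cubeMeasure B ≠ 0) (j : ℕ) :
    ∃ x ∈ B, ∃ y ∈ B, x j ≠ y j ∧ ∀ i, i ≠ j → x i = y i := by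
  by_contra! hcon
  refine hB ?_
  rw [← (measurePreserving_glue {j}).measure_preimage hBm.nullMeasurableSet,
    Measure.prod_apply ((measurePreserving_glue {j}).measurable hBm)]
  refine lintegral_eq_zero_of_ae_eq_zero (Eventually.of_forall fun x => ?_)
  simp only [Pi.zero_apply]
  by_cases hne : ∃ y₀ : ℕ → ℝ, glue {j} (x, y₀) ∈ B
  · obtain ⟨y₀, hy₀⟩ := hne
    have h1 : (Prod.mk x ⁻¹' (glue {j} ⁻¹' B)) ⊆ Function.eval j ⁻¹' {y₀ j} := by
      intro y hy
      by_contra hyy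
      obtain ⟨i, hi, hi'⟩ := hcon _ hy₀ _ hy (by
        simp only [glue, Set.mem_singleton_iff, if_true]
        exact fun h => hyy h.symm)
      exact hi' (by simp [glue, hi])
    refine measure_mono_null h1 ?_
    rw [cubeMeasure, (measurePreserving_eval_infinitePi (fun _ : ℕ => unitMeasure) j).measure_preimage
      (measurableSet_singleton _).nullMeasurableSet]
    simp [unitMeasure]
  · push Not at hne
    have : (Prod.mk x ⁻¹' (glue {j} ⁻¹' B)) = ∅ := by
      ext y; simpa using hne y
    rw [this, measure_empty]

theorem inner_sub_sub_eq {V : Type*} [NormedAddCommGroup V] [InnerProductSpace ℝ V] (p q r s : V) :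
    2 * inner ℝ (p - q) (r - s)
      = ‖p - s‖ ^ 2 + ‖q - r‖ ^ 2 - ‖p - r‖ ^ 2 - ‖q - s‖ ^ 2 := by
  simp only [← real_inner_self_eq_norm_sq, inner_sub_left, inner_sub_right]
  rw [real_inner_comm p r, real_inner_comm p s, real_inner_comm q r, real_inner_comm q s]
  ring

theorem Orthonormal.tendsto_partial_sum {V : Type*} [NormedAddCommGroup V] [InnerProductSpace ℝ V]
    {t : ℕ → V} (ht : Orthonormal ℝ t) {w : V}
    (hw : HasSum (fun j => (inner ℝ (t j) w) ^ 2) (‖w‖ ^ 2)) :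
    Tendsto (fun n => ∑ j ∈ Finset.range n, inner ℝ (t j) w • t j) atTop (𝓝 w) := by
  rw [tendsto_iff_norm_sub_tendsto_zero]
  have h1 : ∀ n, ‖(∑ j ∈ Finset.range n, inner ℝ (t j) w • t j) - w‖ ^ 2
      = ‖w‖ ^ 2 - ∑ j ∈ Finset.range n, (inner ℝ (t j) w) ^ 2 := by
    intro n
    rw [norm_sub_sq_real, sum_inner]
    have h2 : ‖∑ j ∈ Finset.range n, inner ℝ (t j) w • t j‖ ^ 2
        = ∑ j ∈ Finset.range n, (inner ℝ (t j) w) ^ 2 := by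
      rw [← real_inner_self_eq_norm_sq, ht.inner_sum]
      simp [sq]
    rw [h2]
    simp only [real_inner_smul_left, ← sq]
    ring
  have h2 : Tendsto (fun n => ‖(∑ j ∈ Finset.range n, inner ℝ (t j) w • t j) - w‖ ^ 2) atTop
      (𝓝 0) := by
    simp only [h1]
    have h3 := hw.tendsto_sum_nat.const_sub (‖w‖ ^ 2)
    rw [sub_self] at h3
    exact h3
  have h3 := (Real.continuous_sqrt.tendsto _).comp h2
  simpa [Function.comp_def, Real.sqrt_sq] using h3

theorem row_bessel {t : ℕ → Ell} (ht : Orthonormal ℝ t) (i : ℕ) :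
    (Summable fun j => (t j i) ^ 2) ∧ ∑' j, (t j i) ^ 2 ≤ 1 := by
  have h1 : ∀ j, ‖inner ℝ (t j) (lp.single 2 i (1 : ℝ) : Ell)‖ ^ 2 = (t j i) ^ 2 := by
    intro j
    rw [lp.inner_single_right]
    simp
  have h2 := ht.inner_products_summable (lp.single 2 i (1 : ℝ) : Ell)
  have h3 := ht.tsum_inner_products_le (lp.single 2 i (1 : ℝ) : Ell)
  simp only [h1] at h2 h3
  refine ⟨h2, h3.trans ?_⟩
  rw [lp.norm_single (by norm_num)]
  simp

theorem row_summable_abs {a : ℕ → ℝ} (ha : ∀ i, 0 < a i) (hsum : Summable fun i => (a i) ^ 2)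
    {t : ℕ → Ell} (ht : Orthonormal ℝ t) (i : ℕ) :
    Summable fun j => |t j i * a j / a i| := by
  refine Summable.of_nonneg_of_le (fun j => abs_nonneg _) (fun j => ?_)
    (((row_bessel ht i).1.add hsum).mul_right (a i)⁻¹)
  rw [abs_div, abs_of_pos (ha i), div_eq_mul_inv, abs_mul]
  refine mul_le_mul_of_nonneg_right ?_ (inv_pos.2 (ha i)).le
  nlinarith [sq_nonneg (|t j i| - |a j|), sq_abs (t j i), sq_abs (a j), sq_nonneg (t j i),
    sq_nonneg (a j)]

theorem inner_emb_sub {a p q r s : ℕ → ℝ} (hsum : Summable fun i => (a i) ^ 2) (hp : p ∈ cube)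
    (hq : q ∈ cube) (hr : r ∈ cube) (hs : s ∈ cube) {j : ℕ} (h : ∀ i, i ≠ j → r i = s i) :
    (inner ℝ (emb a r - emb a s) (emb a p - emb a q) : ℝ)
      = (a j * (r j - s j)) * (a j * (p j - q j)) := by
  have h1 := Ell.inner_hasSum (emb a r - emb a s) (emb a p - emb a q)
  have h2 : (fun i => (emb a r - emb a s) i * (emb a p - emb a q) i)
      = fun i => (a i * (r i - s i)) * (a i * (p i - q i)) := by
    funext i
    rw [lp.coeFn_sub, Pi.sub_apply, lp.coeFn_sub, Pi.sub_apply, emb_apply hsum hp,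
      emb_apply hsum hq, emb_apply hsum hr, emb_apply hsum hs]; ring
  rw [h2] at h1
  exact h1.unique (hasSum_single j fun i hi => by simp [h i hi])

/-- On a set of positive measure an isometry of the cube is affine in coordinates. -/
theorem exists_orthonormal_of_isIsomOn {a : ℕ → ℝ} (ha : ∀ i, 0 < a i)
    (hsum : Summable fun i => (a i) ^ 2) {f : (ℕ → ℝ) → ℕ → ℝ} {lo hi : ℕ → ℝ}
    (hJ : cylSet lo hi ⊆ cube) (hf : IsIsomOn a f (cylSet lo hi)) {B : Set (ℕ → ℝ)}
    (hBm : MeasurableSet B) (hBf : B ⊆ f '' cylSet lo hi) (hBc : B ⊆ cube)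
    (hB : cubeMeasure B ≠ 0) :
    ∃ t : ℕ → Ell, Orthonormal ℝ t ∧ ∃ c : ℕ → ℝ, ∀ x ∈ B, ∀ i,
      c i + ∑' j, (t j i * a j / a i) * x j ∈ Set.Icc (lo i) (hi i) := by
  have hg : ∀ x, ∃ y, x ∈ B → y ∈ cylSet lo hi ∧ f y = x := fun x => by
    by_cases hx : x ∈ B
    · obtain ⟨y, hy, hyx⟩ := hBf hx
      exact ⟨y, fun _ => ⟨hy, hyx⟩⟩
    · exact ⟨x, fun h => absurd h hx⟩
  choose g hg using hg
  have hnorm : ∀ x ∈ B, ∀ y ∈ B, ‖emb a (g x) - emb a (g y)‖ = ‖emb a x - emb a y‖ := by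
    intro x hx y hy
    rw [norm_emb_sub hsum (hJ (hg x hx).1) (hJ (hg y hy).1), norm_emb_sub hsum (hBc hx) (hBc hy),
      ← hf _ (hg x hx).1 _ (hg y hy).1, (hg x hx).2, (hg y hy).2]
  have hinner : ∀ p ∈ B, ∀ q ∈ B, ∀ r ∈ B, ∀ s ∈ B,
      (inner ℝ (emb a (g p) - emb a (g q)) (emb a (g r) - emb a (g s)) : ℝ)
        = inner ℝ (emb a p - emb a q) (emb a r - emb a s) := by
    intro p hp q hq r hr s hs
    have h1 := inner_sub_sub_eq (emb a (g p)) (emb a (g q)) (emb a (g r)) (emb a (g s))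
    have h2 := inner_sub_sub_eq (emb a p) (emb a q) (emb a r) (emb a s)
    rw [hnorm p hp s hs, hnorm q hq r hr, hnorm p hp r hr, hnorm q hq s hs] at h1
    linarith
  choose X hX Y hY hXY hXY' using fun j => exists_pair hBm hB j
  have hd : ∀ j, a j * (X j j - Y j j) ≠ 0 := fun j =>
    mul_ne_zero (ha j).ne' (sub_ne_zero.2 (hXY j))
  set t : ℕ → Ell := fun j =>
    (a j * (X j j - Y j j))⁻¹ • (emb a (g (X j)) - emb a (g (Y j))) with ht
  have htin : ∀ j, ∀ p ∈ B, ∀ q ∈ B, (inner ℝ (t j) (emb a (g p) - emb a (g q)) : ℝ)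
      = a j * (p j - q j) := by
    intro j p hp q hq
    rw [ht]
    simp only
    rw [real_inner_smul_left, hinner _ (hX j) _ (hY j) _ hp _ hq,
      inner_emb_sub hsum (hBc hp) (hBc hq) (hBc (hX j)) (hBc (hY j)) (hXY' j),
      inv_mul_cancel_left₀ (hd j)]
  have hort : Orthonormal ℝ t := by
    rw [orthonormal_iff_ite]
    intro i j
    have h1 : (inner ℝ (t i) (t j) : ℝ)
        = (a j * (X j j - Y j j))⁻¹ * (a i * (X j i - Y j i)) := by
      rw [← htin i _ (hX j) _ (hY j), ← real_inner_smul_right]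
    rw [h1]
    by_cases hij : i = j
    · subst hij
      rw [if_pos rfl, inv_mul_cancel₀ (hd i)]
    · rw [if_neg hij, hXY' j i hij]; simp
  obtain ⟨z, hz⟩ := nonempty_of_measure_ne_zero hB
  have hexp : ∀ x ∈ B, ∀ i,
      HasSum (fun j => (t j i * a j / a i) * (x j - z j)) (g x i - g z i) := by
    intro x hx i
    have hpars : HasSum (fun j => (inner ℝ (t j) (emb a (g x) - emb a (g z)) : ℝ) ^ 2)
        (‖emb a (g x) - emb a (g z)‖ ^ 2) := by
      rw [hnorm x hx z hz]
      convert Ell.norm_sq (emb a x - emb a z) using 2 with j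
      rw [htin j x hx z hz, lp.coeFn_sub, Pi.sub_apply, emb_apply hsum (hBc hx),
        emb_apply hsum (hBc hz), mul_sub]
    have hlim := hort.tendsto_partial_sum hpars
    have hev : Tendsto (fun n => (∑ j ∈ Finset.range n,
        (inner ℝ (t j) (emb a (g x) - emb a (g z)) : ℝ) • t j : Ell) i) atTop
        (𝓝 ((emb a (g x) - emb a (g z) : Ell) i)) := by
      rw [tendsto_iff_norm_sub_tendsto_zero] at hlim ⊢
      refine squeeze_zero (fun n => norm_nonneg _) (fun n => ?_) hlim
      rw [← Pi.sub_apply, ← lp.coeFn_sub]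
      exact lp.norm_apply_le_norm (by norm_num) _ i
    have hev2 := hev.const_mul (a i)⁻¹
    have hval : (a i)⁻¹ * (emb a (g x) - emb a (g z) : Ell) i = g x i - g z i := by
      rw [lp.coeFn_sub, Pi.sub_apply, emb_apply hsum (hJ (hg x hx).1),
        emb_apply hsum (hJ (hg z hz).1), ← mul_sub, inv_mul_cancel_left₀ (ha i).ne']
    have hsumm : Summable fun j => (t j i * a j / a i) * (x j - z j) := by
      refine Summable.of_norm_bounded (row_summable_abs ha hsum hort i) fun j => ?_
      rw [norm_mul, Real.norm_eq_abs, Real.norm_eq_abs]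
      refine mul_le_of_le_one_right (abs_nonneg _) ?_
      rw [abs_le]
      constructor <;> linarith [(hBc hx j).1, (hBc hx j).2, (hBc hz j).1, (hBc hz j).2]
    convert hsumm.hasSum using 1
    rw [← hval]
    refine tendsto_nhds_unique hev2 (hsumm.hasSum.tendsto_sum_nat.congr fun n => ?_)
    rw [lp.coeFn_sum, Finset.sum_apply, Finset.mul_sum]
    refine Finset.sum_congr rfl fun j _ => ?_
    rw [htin j x hx z hz]
    generalize t j = u
    rw [lp.coeFn_smul, Pi.smul_apply, smul_eq_mul]
    ring
  have hs : ∀ x ∈ B, ∀ i, Summable fun j => (t j i * a j / a i) * x j := by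
    intro x hx i
    refine Summable.of_norm_bounded (row_summable_abs ha hsum hort i) fun j => ?_
    rw [norm_mul, Real.norm_eq_abs, Real.norm_eq_abs]
    refine mul_le_of_le_one_right (abs_nonneg _) ?_
    rw [abs_le]
    constructor <;> linarith [(hBc hx j).1, (hBc hx j).2]
  refine ⟨t, hort, fun i => g z i - ∑' j, (t j i * a j / a i) * z j, fun x hx i => ?_⟩
  have h1 := (hexp x hx i).tsum_eq
  simp only [mul_sub] at h1
  rw [(hs x hx i).tsum_sub (hs z hz i)] at h1
  have h2 : g z i - ∑' j, (t j i * a j / a i) * z j + ∑' j, (t j i * a j / a i) * x j = g x i := by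
    linarith
  rw [h2]
  exact (hg x hx).1 i

end Isometry

section Density
open MeasureTheory
open scoped Classical ENNReal Topology

theorem unitMeasure_apply {t : Set ℝ} (ht : MeasurableSet t) :
    unitMeasure t = volume (t ∩ Set.Icc 0 1) := by
  rw [unitMeasure, Measure.restrict_apply ht]

/-- Rescaling the unit interval to a subinterval `[c / n, (c + 1) / n)`. -/
theorem unitMeasure_inter_floor {n : ℝ} (hn : 0 < n) {c : ℤ} (h0 : 0 ≤ c) (h1 : (c : ℝ) + 1 ≤ n)
    {t : Set ℝ} (ht : MeasurableSet t) :
    unitMeasure (t ∩ {x | ⌊n * x⌋ = c})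
      = ENNReal.ofReal n⁻¹ * unitMeasure.map (fun x => n⁻¹ * (c + x)) t := by
  have hc0 : (0 : ℝ) ≤ c := by exact_mod_cast h0
  have hI : {x : ℝ | ⌊n * x⌋ = c} = Set.Ico (c / n) ((c + 1) / n) := by
    ext x
    rw [Set.mem_ofPred_eq, Int.floor_eq_iff, Set.mem_Ico, div_le_iff₀ hn, lt_div_iff₀ hn, mul_comm]
  have hm : Measurable fun x : ℝ => n⁻¹ * (c + x) := by fun_prop
  rw [Measure.map_apply hm ht, unitMeasure_apply (hm ht), hI,
    unitMeasure_apply (ht.inter measurableSet_Ico)]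
  have e1 : t ∩ Set.Ico (c / n) ((c + 1) / n) ∩ Set.Icc 0 1
      = t ∩ Set.Ico (c / n) ((c + 1) / n) := by
    refine Set.inter_eq_left.2 fun x hx => ?_
    have h2 := hx.2.1
    have h3 := hx.2.2
    refine ⟨(div_nonneg hc0 hn.le).trans h2, h3.le.trans ?_⟩
    rw [div_le_one hn]; exact h1
  have e2 : (fun x : ℝ => n⁻¹ * (c + x)) ⁻¹' t ∩ Set.Icc 0 1
      = (fun x => (c : ℝ) + x) ⁻¹' ((fun x => n⁻¹ * x) ⁻¹' (t ∩ Set.Icc (c / n) ((c + 1) / n))) := by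
    ext x
    simp only [Set.mem_inter_iff, Set.mem_preimage, Set.mem_Icc]
    rw [div_le_iff₀ hn, le_div_iff₀ hn]
    have : n⁻¹ * (c + x) * n = c + x := by field_simp
    rw [this]
    constructor
    · rintro ⟨h, h2, h3⟩; exact ⟨h, by linarith, by linarith⟩
    · rintro ⟨h, h2, h3⟩; exact ⟨h, by linarith, by linarith⟩
  rw [e1, e2, measure_preimage_add, Real.volume_preimage_mul_left (inv_ne_zero hn.ne'), inv_inv,
    abs_of_pos hn, ← mul_assoc, ← ENNReal.ofReal_mul (inv_pos.2 hn).le, inv_mul_cancel₀ hn.ne',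
    ENNReal.ofReal_one, one_mul]
  refine measure_congr ?_
  exact (ae_eq_refl t).inter Ico_ae_eq_Icc

theorem floor_mem_of_unitMeasure_ne_zero {n : ℕ} (hn : 0 < n) {c : ℤ}
    (h : unitMeasure {x | ⌊(n : ℝ) * x⌋ = c} ≠ 0) : 0 ≤ c ∧ (c : ℝ) + 1 ≤ n := by
  by_contra hcon
  refine h ?_
  have hm : MeasurableSet {x : ℝ | ⌊(n : ℝ) * x⌋ = c} :=
    (Int.measurable_floor.comp (measurable_const_mul (n : ℝ))) (measurableSet_singleton c)
  rw [unitMeasure_apply hm]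
  refine measure_mono_null (t := {1}) ?_ (by simp)
  rintro x ⟨hx, hx0, hx1⟩
  rw [Set.mem_ofPred_eq] at hx
  have hn' : (0 : ℝ) < n := by exact_mod_cast hn
  have hc0 : 0 ≤ c := by rw [← hx]; positivity
  have hcn : (n : ℤ) < c + 1 := by
    by_contra! hlt
    exact hcon ⟨hc0, by exact_mod_cast hlt⟩
  have h2 : (n : ℤ) ≤ c := by omega
  rw [← hx, Int.le_floor] at h2
  have h3 : (n : ℝ) ≤ n * x := by exact_mod_cast h2
  have h4 : 1 ≤ x := by
    by_contra! hlt
    nlinarith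
  exact le_antisymm hx1 h4

/-- The affine map carrying the cube onto a grid box in the first `m` coordinates. -/
def boxMap (m n : ℕ) (c : ℕ → ℤ) (x : ℕ → ℝ) : ℕ → ℝ :=
  fun i => if i < m then (n : ℝ)⁻¹ * (c i + x i) else x i

/-- A half-open grid box in the first `m` coordinates. -/
def gridBox (m n : ℕ) (c : ℕ → ℤ) : Set (ℕ → ℝ) := {x | ∀ i < m, ⌊(n : ℝ) * x i⌋ = c i}

theorem measurableSet_gridBox (m n : ℕ) (c : ℕ → ℤ) : MeasurableSet (gridBox m n c) := by
  have : gridBox m n c = ⋂ i, ⋂ (_ : i < m), (fun x : ℕ → ℝ => ⌊(n : ℝ) * x i⌋) ⁻¹' {c i} := by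
    ext; simp [gridBox]
  rw [this]
  refine MeasurableSet.iInter fun i => MeasurableSet.iInter fun _ => ?_
  have h : Measurable fun x : ℕ → ℝ => (n : ℝ) * x i := by fun_prop
  exact (Int.measurable_floor.comp h) (measurableSet_singleton _)

theorem measurable_boxMap (m n : ℕ) (c : ℕ → ℤ) : Measurable (boxMap m n c) := by
  refine measurable_pi_lambda _ fun i => ?_
  unfold boxMap
  split_ifs <;> fun_prop

theorem map_boxMap {m n : ℕ} (hn : 0 < n) {c : ℕ → ℤ} (hc : ∀ i < m, 0 ≤ c i ∧ (c i : ℝ) + 1 ≤ n) :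
    cubeMeasure.map (boxMap m n c)
      = (ENNReal.ofReal (n : ℝ)) ^ m • cubeMeasure.restrict (gridBox m n c) := by
  have hn' : (0 : ℝ) < n := by exact_mod_cast hn
  set ψ : ℕ → ℝ → ℝ := fun i x => if i < m then (n : ℝ)⁻¹ * (c i + x) else x with hψ
  have hψm : ∀ i, Measurable (ψ i) := fun i => by
    rw [hψ]; simp only; split_ifs <;> fun_prop
  have hpm : ∀ i, IsProbabilityMeasure (unitMeasure.map (ψ i)) := fun i =>
    Measure.isProbabilityMeasure_map (hψm i).aemeasurable
  have h1 : cubeMeasure.map (boxMap m n c)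
      = Measure.infinitePi fun i => unitMeasure.map (ψ i) := by
    unfold cubeMeasure
    rw [← Measure.infinitePi_map_pi _ hψm]
    rfl
  rw [h1]
  symm
  refine Measure.eq_infinitePi _ fun s t ht => ?_
  have hI : ∀ i, MeasurableSet {x : ℝ | ⌊(n : ℝ) * x⌋ = c i} := fun i =>
    (Int.measurable_floor.comp (measurable_const_mul (n : ℝ))) (measurableSet_singleton (c i))
  have ht' : ∀ i, MeasurableSet (if i ∈ s then t i else Set.univ) := fun i => by
    split_ifs
    exacts [ht i, MeasurableSet.univ]
  have hset : Set.pi s t ∩ gridBox m n c = Set.pi ((s ∪ Finset.range m : Finset ℕ) : Set ℕ)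
      fun i => (if i ∈ s then t i else Set.univ) ∩
        (if i < m then {x : ℝ | ⌊(n : ℝ) * x⌋ = c i} else Set.univ) := by
    ext x
    simp only [Set.mem_inter_iff, Set.mem_pi, gridBox, Set.mem_ofPred_eq, SetLike.mem_coe,
      Finset.mem_union, Finset.mem_range]
    constructor
    · rintro ⟨h2, h3⟩ i hi
      constructor
      · split_ifs with h
        exacts [h2 i h, trivial]
      · split_ifs with h
        exacts [h3 i h, trivial]
    · intro h
      refine ⟨fun i hi => ?_, fun i hi => ?_⟩
      · have := (h i (Or.inl hi)).1
        rwa [if_pos hi] at this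
      · have := (h i (Or.inr hi)).2
        rwa [if_pos hi] at this
  rw [Measure.smul_apply, smul_eq_mul,
    Measure.restrict_apply (MeasurableSet.pi s.countable_toSet fun i _ => ht i), hset, cubeMeasure,
    Measure.infinitePi_pi]
  · have hfac : ∀ i, unitMeasure ((if i ∈ s then t i else Set.univ) ∩
        (if i < m then {x : ℝ | ⌊(n : ℝ) * x⌋ = c i} else Set.univ))
        = (if i < m then ENNReal.ofReal (n : ℝ)⁻¹ else 1) *
          (if i ∈ s then unitMeasure.map (ψ i) (t i) else 1) := by
      intro i
      have e1 : (if i ∈ s then unitMeasure.map (ψ i) (t i) else 1)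
          = unitMeasure.map (ψ i) (if i ∈ s then t i else Set.univ) := by
        have := hpm i
        split_ifs
        · rfl
        · rw [measure_univ]
      rw [e1]
      by_cases him : i < m
      · rw [if_pos him, if_pos him, unitMeasure_inter_floor hn' (hc i him).1 (hc i him).2 (ht' i)]
        simp only [hψ, if_pos him]
      · rw [if_neg him, if_neg him, Set.inter_univ, one_mul]
        simp only [hψ, if_neg him]
        rw [Measure.map_id']
    rw [Finset.prod_congr rfl fun i _ => hfac i, Finset.prod_mul_distrib, Finset.prod_ite_mem,
      Finset.union_inter_cancel_left]
    have e2 : ∏ i ∈ s ∪ Finset.range m, (if i < m then ENNReal.ofReal (n : ℝ)⁻¹ else 1)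
        = ENNReal.ofReal (n : ℝ)⁻¹ ^ m := by
      simp only [← Finset.mem_range]
      rw [Finset.prod_ite_mem, Finset.union_inter_cancel_right, Finset.prod_const,
        Finset.card_range]
    rw [e2, ← mul_assoc, ← mul_pow, ← ENNReal.ofReal_mul hn'.le, mul_inv_cancel₀ hn'.ne',
      ENNReal.ofReal_one, one_pow, one_mul]
  · intro i _
    refine (ht' i).inter ?_
    split_ifs
    exacts [hI i, MeasurableSet.univ]

/-- A closed set of positive measure fills some box up to a small proportion. -/
theorem exists_box_density {B : Set (ℕ → ℝ)} (hBc : IsClosed B) (hB : cubeMeasure B ≠ 0) {ε : ℝ≥0∞}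
    (hε : 0 < ε) : ∃ (n0 : ℕ) (q δ : ℕ → ℝ), (∀ j, 0 < δ j ∧ δ j ≤ 1) ∧
      (∀ j, n0 ≤ j → q j = 0 ∧ δ j = 1) ∧
      1 - ε ≤ cubeMeasure ((fun x j => q j + δ j * x j) ⁻¹' B) := by
  have hBm := hBc.measurableSet
  set C : ℕ → Set (ℕ → ℝ) := fun m =>
    {x | ∃ y ∈ B, ∀ i < m, ⌊((2 ^ m : ℕ) : ℝ) * x i⌋ = ⌊((2 ^ m : ℕ) : ℝ) * y i⌋} with hC
  set ext : ∀ m, (Fin m → ℤ) → ℕ → ℤ := fun m c i => if h : i < m then c ⟨i, h⟩ else 0 with hext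
  set Q : ∀ m, (Fin m → ℤ) → Set (ℕ → ℝ) := fun m c => gridBox m (2 ^ m) (ext m c) with hQ
  have hQmem : ∀ m c x, x ∈ Q m c ↔ (fun i : Fin m => ⌊((2 ^ m : ℕ) : ℝ) * x i⌋) = c := by
    intro m c x
    rw [hQ, funext_iff]
    simp only [gridBox, Set.mem_ofPred_eq, hext]
    constructor
    · intro h i
      have := h i i.2
      simpa using this
    · intro h i hi
      simpa [hi] using h ⟨i, hi⟩
  have hCQ : ∀ m, C m = ⋃ c : {c : Fin m → ℤ // (Q m c ∩ B).Nonempty}, Q m c := by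
    intro m
    ext x
    simp only [Set.mem_iUnion]
    constructor
    · rintro ⟨y, hy, hxy⟩
      refine ⟨⟨fun i : Fin m => ⌊((2 ^ m : ℕ) : ℝ) * x i⌋, y, ?_, hy⟩, ?_⟩
      · exact (hQmem _ _ _).2 (funext fun i => (hxy i i.2).symm)
      · exact (hQmem _ _ _).2 rfl
    · rintro ⟨⟨c, y, hy, hyB⟩, hx⟩
      rw [hQmem] at hy hx
      refine ⟨y, hyB, fun i hi => ?_⟩
      have h1 := congrFun (hx.trans hy.symm) ⟨i, hi⟩
      exact h1
  have hQm : ∀ m c, MeasurableSet (Q m c) := fun m c => measurableSet_gridBox _ _ _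
  have hCm : ∀ m, MeasurableSet (C m) := fun m => by
    rw [hCQ]; exact MeasurableSet.iUnion fun c => hQm _ _
  have hanti : Antitone C := by
    refine antitone_nat_of_succ_le fun m => ?_
    rintro x ⟨y, hy, hxy⟩
    refine ⟨y, hy, fun i hi => ?_⟩
    have h1 := hxy i (by omega)
    have h2 : ∀ z : ℝ, ⌊((2 ^ m : ℕ) : ℝ) * z⌋ = ⌊((2 ^ (m + 1) : ℕ) : ℝ) * z⌋ / ((2 : ℕ) : ℤ) := by
      intro z
      rw [← Int.floor_div_natCast]
      congr 1
      push_cast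
      ring
    rw [h2, h2, h1]
  have hBC : ∀ m, B ⊆ C m := fun m y hy => ⟨y, hy, fun i _ => rfl⟩
  have hinter : ⋂ m, C m = B := by
    refine Set.Subset.antisymm (fun x hx => ?_) (Set.subset_iInter hBC)
    rw [Set.mem_iInter] at hx
    choose y hyB hy using hx
    refine hBc.mem_of_tendsto (f := y) (b := atTop) ?_ (Eventually.of_forall hyB)
    rw [tendsto_pi_nhds]
    intro i
    rw [tendsto_iff_dist_tendsto_zero]
    have h1 : Tendsto (fun m : ℕ => (1 / 2 : ℝ) ^ m) atTop (𝓝 0) :=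
      tendsto_pow_atTop_nhds_zero_of_lt_one (by norm_num) (by norm_num)
    refine squeeze_zero' (Eventually.of_forall fun _ => dist_nonneg) ?_ h1
    filter_upwards [eventually_gt_atTop i] with m hm
    have h2 := Int.abs_sub_lt_one_of_floor_eq_floor (hy m i hm)
    rw [← mul_sub, abs_mul, abs_of_pos (by positivity)] at h2
    push_cast at h2
    rw [Real.dist_eq, abs_sub_comm, one_div, inv_pow, ← one_div, le_div_iff₀' (by positivity)]
    exact h2.le
  have hlim : Tendsto (fun m => cubeMeasure (C m)) atTop (𝓝 (cubeMeasure B)) := by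
    rw [← hinter]
    exact tendsto_measure_iInter_atTop (fun m => (hCm m).nullMeasurableSet) hanti
      ⟨0, measure_ne_top _ _⟩
  obtain ⟨m, hm2⟩ : ∃ m, (1 - ε) * cubeMeasure (C m) < cubeMeasure B := by
    have h1 : (1 - ε) * cubeMeasure B < cubeMeasure B := by
      have h2 := ENNReal.mul_lt_mul_left hB (measure_ne_top cubeMeasure B)
        (ENNReal.sub_lt_self ENNReal.one_ne_top one_ne_zero hε.ne')
      rwa [one_mul] at h2
    have h3 : Tendsto (fun m => (1 - ε) * cubeMeasure (C m)) atTop (𝓝 ((1 - ε) * cubeMeasure B)) :=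
      ENNReal.Tendsto.const_mul hlim (Or.inr (ENNReal.sub_ne_top ENNReal.one_ne_top))
    exact (h3.eventually (gt_mem_nhds h1)).exists
  obtain ⟨c, hc0, hc⟩ : ∃ c, cubeMeasure (Q m c) ≠ 0 ∧
      (1 - ε) * cubeMeasure (Q m c) ≤ cubeMeasure (B ∩ Q m c) := by
    by_contra! hcon
    refine absurd hm2 (not_lt.2 ?_)
    have hdis : Pairwise (Function.onFun Disjoint
        fun c : {c : Fin m → ℤ // (Q m c ∩ B).Nonempty} => Q m c) := by
      intro c c' hcc
      refine Set.disjoint_left.2 fun x hx hx' => hcc ?_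
      rw [hQmem] at hx hx'
      exact Subtype.ext (hx.symm.trans hx')
    have hBe : cubeMeasure B
        = cubeMeasure (⋃ c : {c : Fin m → ℤ // (Q m c ∩ B).Nonempty}, B ∩ Q m c) := by
      rw [← Set.inter_iUnion, ← hCQ, Set.inter_eq_left.2 (hBC m)]
    rw [hBe, hCQ, measure_iUnion hdis (fun c => hQm _ _), ← ENNReal.tsum_mul_left]
    refine (measure_iUnion_le _).trans (ENNReal.tsum_le_tsum fun c => ?_)
    by_cases h0 : cubeMeasure (Q m c) = 0
    · rw [measure_mono_null Set.inter_subset_right h0]; exact zero_le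
    · exact (hcon c h0).le
  have hn : 0 < 2 ^ m := by positivity
  have hrange : ∀ i < m, 0 ≤ ext m c i ∧ (ext m c i : ℝ) + 1 ≤ (2 ^ m : ℕ) := by
    intro i hi
    refine floor_mem_of_unitMeasure_ne_zero hn fun h0 => hc0 ?_
    have hmp := measurePreserving_eval_infinitePi (fun _ : ℕ => unitMeasure) i
    refine measure_mono_null (t := Function.eval i ⁻¹' {x | ⌊((2 ^ m : ℕ) : ℝ) * x⌋ = ext m c i})
      (fun x hx => hx i hi) ?_
    rw [cubeMeasure, hmp.measure_preimage]
    · exact h0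
    · exact ((Int.measurable_floor.comp (measurable_const_mul _))
        (measurableSet_singleton _)).nullMeasurableSet
  have hmap := map_boxMap hn hrange
  refine ⟨m, fun j => if j < m then ((2 ^ m : ℕ) : ℝ)⁻¹ * ext m c j else 0,
    fun j => if j < m then ((2 ^ m : ℕ) : ℝ)⁻¹ else 1, fun j => ?_, fun j hj => ?_, ?_⟩
  · beta_reduce
    split_ifs
    · refine ⟨by positivity, inv_le_one_of_one_le₀ ?_⟩
      exact_mod_cast hn
    · norm_num
  · simp [not_lt.2 hj]
  · have hbm : (fun (x : ℕ → ℝ) j => (if j < m then ((2 ^ m : ℕ) : ℝ)⁻¹ * ext m c j else 0)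
        + (if j < m then ((2 ^ m : ℕ) : ℝ)⁻¹ else 1) * x j) = boxMap m (2 ^ m) (ext m c) := by
      funext x j
      unfold boxMap
      split_ifs <;> ring
    rw [hbm, ← Measure.map_apply (measurable_boxMap _ _ _) hBm, hmap, Measure.smul_apply,
      smul_eq_mul, Measure.restrict_apply hBm]
    have huniv : (cubeMeasure.map (boxMap m (2 ^ m) (ext m c))) Set.univ = 1 := by
      rw [Measure.map_apply (measurable_boxMap _ _ _) MeasurableSet.univ, Set.preimage_univ,
        measure_univ]
    rw [hmap, Measure.smul_apply, smul_eq_mul, Measure.restrict_apply_univ] at huniv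
    calc 1 - ε = (1 - ε) * (ENNReal.ofReal ((2 ^ m : ℕ) : ℝ) ^ m
          * cubeMeasure (gridBox m (2 ^ m) (ext m c))) := by rw [huniv, mul_one]
      _ = ENNReal.ofReal ((2 ^ m : ℕ) : ℝ) ^ m
          * ((1 - ε) * cubeMeasure (gridBox m (2 ^ m) (ext m c))) := by ring
      _ ≤ _ := mul_le_mul_right hc _

end Density

section Moments
open MeasureTheory ProbabilityTheory
open scoped Classical ENNReal Topology

theorem integrable_of_bounded_on_cube {f : (ℕ → ℝ) → ℝ} (hf : Measurable f) {C : ℝ}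
    (hC : ∀ x ∈ cube, |f x| ≤ C) : Integrable f cubeMeasure :=
  Integrable.of_bound hf.aestronglyMeasurable C
    (ae_mem_cube.mono fun x hx => hC x hx)

theorem abs_sub_half_le {x : ℕ → ℝ} (hx : x ∈ cube) (j : ℕ) : |x j - 1 / 2| ≤ 1 / 2 := by
  rw [abs_le]; constructor <;> linarith [(hx j).1, (hx j).2]

theorem integral_coord (g : ℝ → ℝ) (hg : Measurable g) (j : ℕ) :
    ∫ x, g (x j) ∂cubeMeasure = ∫ u in (0 : ℝ)..1, g u := by
  have hmp := measurePreserving_eval_infinitePi (fun _ : ℕ => unitMeasure) j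
  have h1 : ∫ x, g (Function.eval j x) ∂cubeMeasure = ∫ u, g u ∂unitMeasure := by
    rw [← hmp.map_eq, integral_map hmp.measurable.aemeasurable hg.aestronglyMeasurable]
    rfl
  rw [intervalIntegral.integral_of_le zero_le_one, ← integral_Icc_eq_integral_Ioc]
  exact h1

theorem integral_sub_half_pow (j b : ℕ) :
    ∫ x, (x j - 1 / 2) ^ b ∂cubeMeasure
      = ((1 / 2) ^ (b + 1) - (-(1 / 2)) ^ (b + 1)) / (b + 1) := by
  rw [integral_coord (fun u => (u - 1 / 2) ^ b) (by fun_prop),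
    intervalIntegral.integral_comp_sub_right (fun u : ℝ => u ^ b), integral_pow]
  norm_num

theorem iIndepFun_coord (α : ℕ → ℝ) :
    iIndepFun (fun j (x : ℕ → ℝ) => α j * (x j - 1 / 2)) cubeMeasure :=
  iIndepFun_infinitePi (P := fun _ : ℕ => unitMeasure) (X := fun j (u : ℝ) => α j * (u - 1 / 2))
    fun j => by fun_prop

/-- The centred partial sums. -/
def partSum (α : ℕ → ℝ) (n : ℕ) (x : ℕ → ℝ) : ℝ := ∑ j ∈ Finset.range n, α j * (x j - 1 / 2)

theorem measurable_partSum (α : ℕ → ℝ) (n : ℕ) : Measurable (partSum α n) := by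
  unfold partSum; fun_prop

theorem abs_partSum_le (α : ℕ → ℝ) (n : ℕ) {x : ℕ → ℝ} (hx : x ∈ cube) :
    |partSum α n x| ≤ ∑ j ∈ Finset.range n, |α j| := by
  refine (Finset.abs_sum_le_sum_abs _ _).trans (Finset.sum_le_sum fun j _ => ?_)
  rw [abs_mul]
  exact mul_le_of_le_one_right (abs_nonneg _) ((abs_sub_half_le hx j).trans (by norm_num))

theorem integral_partSum_mul (α : ℕ → ℝ) (n a b : ℕ) :
    ∫ x, partSum α n x ^ a * (α n * (x n - 1 / 2)) ^ b ∂cubeMeasure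
      = (∫ x, partSum α n x ^ a ∂cubeMeasure) *
        (α n ^ b * (((1 / 2) ^ (b + 1) - (-(1 / 2)) ^ (b + 1)) / (b + 1))) := by
  have h1 := (iIndepFun_coord α).indepFun_finsetSum_of_notMem (fun j => by fun_prop)
    (s := Finset.range n) (i := n) (by simp)
  have h2 := h1.comp (φ := fun u : ℝ => u ^ a) (ψ := fun u : ℝ => u ^ b) (by fun_prop) (by fun_prop)
  have h3 : (fun u : ℝ => u ^ a) ∘ (∑ j ∈ Finset.range n, fun x : ℕ → ℝ => α j * (x j - 1 / 2))
      = fun x => partSum α n x ^ a := by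
    funext x; simp [partSum]
  rw [h3] at h2
  have h4 := h2.integral_fun_mul_eq_mul_integral
    ((measurable_partSum α n).pow_const a).aestronglyMeasurable
    (Measurable.aestronglyMeasurable (by fun_prop))
  simp only [Function.comp_def] at h4
  rw [h4]
  congr 1
  simp only [mul_pow]
  rw [integral_const_mul, integral_sub_half_pow]

theorem integral_partSum_succ (α : ℕ → ℝ) (n k : ℕ) :
    ∫ x, partSum α (n + 1) x ^ k ∂cubeMeasure
      = ∑ m ∈ Finset.range (k + 1), (∫ x, partSum α n x ^ m ∂cubeMeasure) *
        (α n ^ (k - m) * (((1 / 2) ^ (k - m + 1) - (-(1 / 2)) ^ (k - m + 1))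
          / ((k - m : ℕ) + 1))) * (k.choose m) := by
  have h1 : ∀ x, partSum α (n + 1) x ^ k = ∑ m ∈ Finset.range (k + 1),
      partSum α n x ^ m * (α n * (x n - 1 / 2)) ^ (k - m) * (k.choose m) := by
    intro x
    rw [← add_pow, partSum, Finset.sum_range_succ]; rfl
  simp only [h1]
  rw [integral_finsetSum]
  · refine Finset.sum_congr rfl fun m _ => ?_
    rw [integral_mul_const, integral_partSum_mul]
  · intro m _
    refine (integrable_of_bounded_on_cube (C := (∑ j ∈ Finset.range n, |α j|) ^ m
      * |α n| ^ (k - m)) ?_ fun x hx => ?_).mul_const _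
    · have := measurable_partSum α n
      fun_prop
    · rw [abs_mul, abs_pow, abs_pow, abs_mul]
      refine mul_le_mul (pow_le_pow_left₀ (abs_nonneg _) (abs_partSum_le α n hx) _)
        (pow_le_pow_left₀ (by positivity) ?_ _) (by positivity) (by positivity)
      exact mul_le_of_le_one_right (abs_nonneg _) ((abs_sub_half_le hx n).trans (by norm_num))

theorem partSum_moments (α : ℕ → ℝ) (n : ℕ) :
    ∫ x, partSum α n x ^ 2 ∂cubeMeasure = (∑ j ∈ Finset.range n, α j ^ 2) / 12 ∧
    ∫ x, partSum α n x ^ 4 ∂cubeMeasure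
      = (∑ j ∈ Finset.range n, α j ^ 2) ^ 2 / 48 - (∑ j ∈ Finset.range n, α j ^ 4) / 120 ∧
    ∫ x, partSum α n x ^ 6 ∂cubeMeasure
      = 5 * (∑ j ∈ Finset.range n, α j ^ 2) ^ 3 / 576
        - (∑ j ∈ Finset.range n, α j ^ 2) * (∑ j ∈ Finset.range n, α j ^ 4) / 96
        + (∑ j ∈ Finset.range n, α j ^ 6) / 252 ∧
    ∫ x, partSum α n x ^ 8 ∂cubeMeasure ≤ 105 * (∑ j ∈ Finset.range n, α j ^ 2) ^ 4 / 20736 := by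
  induction n with
  | zero => simp [partSum]
  | succ n ih =>
    obtain ⟨h2, h4, h6, h8⟩ := ih
    have e0 : ∫ x, partSum α n x ^ 0 ∂cubeMeasure = 1 := by simp
    set V := ∑ j ∈ Finset.range n, α j ^ 2 with hV
    set K := ∑ j ∈ Finset.range n, α j ^ 4 with hK
    set L := ∑ j ∈ Finset.range n, α j ^ 6 with hL
    have hV0 : 0 ≤ V := Finset.sum_nonneg fun j _ => by positivity
    have hK0 : 0 ≤ K := Finset.sum_nonneg fun j _ => by positivity
    have hKV : L ≤ V * K := by
      rw [hL, hV, hK, Finset.sum_mul]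
      refine Finset.sum_le_sum fun j hj => ?_
      have : α j ^ 4 ≤ ∑ j ∈ Finset.range n, α j ^ 4 :=
        Finset.single_le_sum (f := fun j => α j ^ 4) (fun i _ => by positivity) hj
      calc α j ^ 6 = α j ^ 2 * α j ^ 4 := by ring
        _ ≤ _ := mul_le_mul_of_nonneg_left this (by positivity)
    rw [Finset.sum_range_succ, Finset.sum_range_succ, Finset.sum_range_succ, ← hV, ← hK, ← hL]
    refine ⟨?_, ?_, ?_, ?_⟩
    · rw [integral_partSum_succ]
      simp only [Finset.sum_range_succ, Finset.sum_range_zero]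
      norm_num [Nat.choose]
      rw [h2]; ring
    · rw [integral_partSum_succ]
      simp only [Finset.sum_range_succ, Finset.sum_range_zero]
      norm_num [Nat.choose]
      rw [h2, h4]; ring
    · rw [integral_partSum_succ]
      simp only [Finset.sum_range_succ, Finset.sum_range_zero]
      norm_num [Nat.choose]
      rw [h2, h4, h6]; ring
    · rw [integral_partSum_succ]
      simp only [Finset.sum_range_succ, Finset.sum_range_zero]
      norm_num [Nat.choose]
      rw [h2, h4, h6]
      have e1 : 0 ≤ α n ^ 2 := by positivity
      have e2 : 0 ≤ α n ^ 4 * K := by positivity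
      have e3 : 0 ≤ α n ^ 2 * (V * K - L) := mul_nonneg e1 (by linarith)
      have e4 : 0 ≤ α n ^ 2 * (V * K) := by positivity
      have e5 : 0 ≤ α n ^ 4 * V ^ 2 := by positivity
      have e6 : 0 ≤ α n ^ 6 * V := by positivity
      have e7 : 0 ≤ α n ^ 8 := by positivity
      nlinarith [e1, e2, e3, e4, e5, e6, e7, h8]

/-- The centred linear form with coefficients `α`. -/
def rowSum (α x : ℕ → ℝ) : ℝ := ∑' j, α j * (x j - 1 / 2)

theorem measurable_rowSum (α : ℕ → ℝ) : Measurable (rowSum α) :=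
  Measurable.tsum fun j => by fun_prop

theorem abs_rowTerm_le (α : ℕ → ℝ) {x : ℕ → ℝ} (hx : x ∈ cube) (j : ℕ) :
    |α j * (x j - 1 / 2)| ≤ |α j| := by
  rw [abs_mul]
  exact mul_le_of_le_one_right (abs_nonneg _) ((abs_sub_half_le hx j).trans (by norm_num))

theorem summable_rowTerm {α : ℕ → ℝ} (hα : Summable fun j => |α j|) {x : ℕ → ℝ} (hx : x ∈ cube) :
    Summable fun j => α j * (x j - 1 / 2) :=
  Summable.of_norm_bounded hα fun j => abs_rowTerm_le α hx j

theorem abs_partSum_le_tsum {α : ℕ → ℝ} (hα : Summable fun j => |α j|) (n : ℕ) {x : ℕ → ℝ}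
    (hx : x ∈ cube) : |partSum α n x| ≤ ∑' j, |α j| :=
  (abs_partSum_le α n hx).trans (hα.sum_le_tsum _ fun _ _ => abs_nonneg _)

theorem tendsto_partSum {α : ℕ → ℝ} (hα : Summable fun j => |α j|) {x : ℕ → ℝ} (hx : x ∈ cube) :
    Tendsto (fun n => partSum α n x) atTop (𝓝 (rowSum α x)) :=
  (summable_rowTerm hα hx).hasSum.tendsto_sum_nat

theorem abs_rowSum_le {α : ℕ → ℝ} (hα : Summable fun j => |α j|) {x : ℕ → ℝ} (hx : x ∈ cube) :
    |rowSum α x| ≤ ∑' j, |α j| :=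
  le_of_tendsto (tendsto_partSum hα hx).abs
    (Eventually.of_forall fun n => abs_partSum_le_tsum hα n hx)

theorem tendsto_integral_partSum {α : ℕ → ℝ} (hα : Summable fun j => |α j|) (k : ℕ) :
    Tendsto (fun n => ∫ x, partSum α n x ^ k ∂cubeMeasure) atTop
      (𝓝 (∫ x, rowSum α x ^ k ∂cubeMeasure)) := by
  refine tendsto_integral_of_dominated_convergence (fun _ => (∑' j, |α j|) ^ k)
    (fun n => ((measurable_partSum α n).pow_const k).aestronglyMeasurable) (integrable_const _)
    (fun n => ae_mem_cube.mono fun x hx => ?_) (ae_mem_cube.mono fun x hx => ?_)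
  · rw [Real.norm_eq_abs, abs_pow]
    exact pow_le_pow_left₀ (abs_nonneg _) (abs_partSum_le_tsum hα n hx) k
  · exact (tendsto_partSum hα hx).pow k

theorem integrable_rowSum_pow {α : ℕ → ℝ} (hα : Summable fun j => |α j|) (k : ℕ) :
    Integrable (fun x => rowSum α x ^ k) cubeMeasure :=
  integrable_of_bounded_on_cube ((measurable_rowSum α).pow_const k) (C := (∑' j, |α j|) ^ k)
    fun x hx => by
      rw [abs_pow]; exact pow_le_pow_left₀ (abs_nonneg _) (abs_rowSum_le hα hx) k

theorem summable_pow_of_summable_abs {α : ℕ → ℝ} (hα : Summable fun j => |α j|) (k : ℕ) :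
    Summable fun j => α j ^ (k + 1) := by
  refine Summable.of_norm_bounded (hα.mul_left ((∑' j, |α j|) ^ k)) fun j => ?_
  rw [Real.norm_eq_abs, abs_pow, pow_succ]
  exact mul_le_mul_of_nonneg_right (pow_le_pow_left₀ (abs_nonneg _)
    (hα.le_tsum j fun i _ => abs_nonneg _) k) (abs_nonneg _)

theorem rowSum_moments {α : ℕ → ℝ} (hα : Summable fun j => |α j|) :
    ∫ x, rowSum α x ^ 2 ∂cubeMeasure = (∑' j, α j ^ 2) / 12 ∧
    ∫ x, rowSum α x ^ 4 ∂cubeMeasure = (∑' j, α j ^ 2) ^ 2 / 48 - (∑' j, α j ^ 4) / 120 ∧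
    ∫ x, rowSum α x ^ 6 ∂cubeMeasure
      = 5 * (∑' j, α j ^ 2) ^ 3 / 576 - (∑' j, α j ^ 2) * (∑' j, α j ^ 4) / 96
        + (∑' j, α j ^ 6) / 252 ∧
    ∫ x, rowSum α x ^ 8 ∂cubeMeasure ≤ 105 * (∑' j, α j ^ 2) ^ 4 / 20736 := by
  have h2 := (summable_pow_of_summable_abs hα 1).hasSum.tendsto_sum_nat
  have h4 := (summable_pow_of_summable_abs hα 3).hasSum.tendsto_sum_nat
  have h6 := (summable_pow_of_summable_abs hα 5).hasSum.tendsto_sum_nat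
  norm_num at h2 h4 h6
  refine ⟨tendsto_nhds_unique ((tendsto_integral_partSum hα 2).congr
    fun n => (partSum_moments α n).1) (h2.div_const _), ?_, ?_, ?_⟩
  · exact tendsto_nhds_unique ((tendsto_integral_partSum hα 4).congr
      fun n => (partSum_moments α n).2.1) (((h2.pow 2).div_const _).sub (h4.div_const _))
  · exact tendsto_nhds_unique ((tendsto_integral_partSum hα 6).congr
      fun n => (partSum_moments α n).2.2.1) (((((h2.pow 3).const_mul 5).div_const _).sub
        ((h2.mul h4).div_const _)).add (h6.div_const _))
  · exact le_of_tendsto_of_tendsto' (tendsto_integral_partSum hα 8)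
      (((h2.pow 4).const_mul 105).div_const _) fun n => (partSum_moments α n).2.2.2

/-- The law of the linear form is symmetric. -/
theorem measureReal_abs_rowSum {α : ℕ → ℝ} {s : Set ℝ} (hs : MeasurableSet s) :
    cubeMeasure.real {x | -rowSum α x ∈ s} = cubeMeasure.real {x | rowSum α x ∈ s} := by
  have hm : MeasurableSet {x | rowSum α x ∈ s} := measurable_rowSum α hs
  rw [measureReal_def, measureReal_def, ← measurePreserving_reflect.measure_preimage
    hm.nullMeasurableSet]
  congr 2
  ext x
  simp only [Set.mem_ofPred_eq, Set.mem_preimage]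
  have : rowSum α (fun i => 1 - x i) = -rowSum α x := by
    rw [rowSum, rowSum, ← tsum_neg]
    congr 1; funext j; ring
  rw [this]

/-- A linear form of nearly full variance which rarely exceeds `1 / 2` has a dominating
coefficient. -/
theorem exists_large_coeff {α : ℕ → ℝ} (hα : Summable fun j => |α j|)
    (hv : 98 / 100 ≤ ∑' j, α j ^ 2)
    (hP : cubeMeasure.real {x | 1 / 2 < rowSum α x} ≤ 1 / 10 ^ 10) :
    ∃ j, 35 / 100 ≤ α j ^ 2 := by
  by_contra! hcon
  -- normalise the variance to be at most one
  obtain ⟨c, hc0, hc1, hv1, hv2⟩ : ∃ c : ℝ, 0 < c ∧ c ≤ 1 ∧ 98 / 100 ≤ c ^ 2 * ∑' j, α j ^ 2 ∧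
      c ^ 2 * ∑' j, α j ^ 2 ≤ 1 := by
    rcases le_total (∑' j, α j ^ 2) 1 with h | h
    · exact ⟨1, one_pos, le_rfl, by linarith, by linarith⟩
    · have hpos : 0 < ∑' j, α j ^ 2 := by linarith
      refine ⟨(Real.sqrt (∑' j, α j ^ 2))⁻¹, by positivity, inv_le_one_of_one_le₀ ?_, ?_, ?_⟩
      · exact Real.one_le_sqrt.2 h
      · rw [inv_pow, Real.sq_sqrt hpos.le, inv_mul_cancel₀ hpos.ne']; norm_num
      · rw [inv_pow, Real.sq_sqrt hpos.le, inv_mul_cancel₀ hpos.ne']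
  have hβ : Summable fun j => |c * α j| := by
    simp only [abs_mul]; exact hα.mul_left _
  have hrow : ∀ x, rowSum (fun j => c * α j) x = c * rowSum α x := by
    intro x
    simp only [rowSum, mul_assoc]
    rw [tsum_mul_left]
  set β : ℕ → ℝ := fun j => c * α j with hβd
  have hV : ∑' j, β j ^ 2 = c ^ 2 * ∑' j, α j ^ 2 := by
    simp only [hβd, mul_pow]; rw [tsum_mul_left]
  rw [← hV] at hv1 hv2
  have hβ2 : ∀ j, β j ^ 2 ≤ 35 / 100 := by
    intro j
    simp only [hβd, mul_pow]
    have h1 : c ^ 2 ≤ 1 := pow_le_one₀ hc0.le hc1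
    nlinarith [hcon j, sq_nonneg (α j)]
  obtain ⟨-, m4, m6, m8⟩ := rowSum_moments hβ
  set V := ∑' j, β j ^ 2
  set K := ∑' j, β j ^ 4
  set L := ∑' j, β j ^ 6
  have hL : 0 ≤ L := tsum_nonneg fun j => by positivity
  have hK : 0 ≤ K := tsum_nonneg fun j => by positivity
  have hKV : K ≤ 35 / 100 * V := by
    rw [← tsum_mul_left]
    refine (summable_pow_of_summable_abs hβ 3).tsum_le_tsum (fun j => ?_)
      ((summable_pow_of_summable_abs hβ 1).mul_left _)
    have : β j ^ 4 = β j ^ 2 * β j ^ 2 := by ring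
    rw [this]
    exact mul_le_mul_of_nonneg_right (hβ2 j) (sq_nonneg _)
  set A : Set (ℕ → ℝ) := {x | 1 / 2 < |rowSum β x|} with hA
  have hAm : MeasurableSet A := measurableSet_lt measurable_const (measurable_rowSum β).abs
  have hPA : cubeMeasure.real A ≤ 2 / 10 ^ 10 := by
    have h1 : A ⊆ {x | 1 / 2 < rowSum α x} ∪ {x | -rowSum α x ∈ Set.Ioi (1 / 2)} := by
      intro x hx
      have h3 : 1 / 2 < |rowSum α x| := by
        refine lt_of_lt_of_le hx ?_
        rw [hrow, abs_mul, abs_of_pos hc0]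
        exact mul_le_of_le_one_left (abs_nonneg _) hc1
      rcases lt_abs.1 h3 with h | h
      · exact Or.inl h
      · exact Or.inr h
    refine (measureReal_mono h1).trans ((measureReal_union_le _ _).trans ?_)
    rw [measureReal_abs_rowSum measurableSet_Ioi]
    have h4 : {x | rowSum α x ∈ Set.Ioi (1 / 2)} = {x | 1 / 2 < rowSum α x} := rfl
    rw [h4]
    norm_num at hP ⊢
    linarith
  have hpt : ∀ x, rowSum β x ^ 6 - rowSum β x ^ 4 / 4
      ≤ 1 / 50 * rowSum β x ^ 8 + A.indicator (fun _ => (50 : ℝ) ^ 3) x := by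
    intro x
    set y := rowSum β x with hy
    by_cases hx : x ∈ A
    · rw [Set.indicator_of_mem hx]
      rcases le_total (y ^ 2) 50 with h | h
      · have h5 : (y ^ 2) ^ 3 ≤ 50 ^ 3 := pow_le_pow_left₀ (sq_nonneg _) h 3
        nlinarith [pow_nonneg (sq_nonneg y) 4, pow_nonneg (sq_nonneg y) 2]
      · have h5 : 50 * (y ^ 2) ^ 3 ≤ y ^ 2 * (y ^ 2) ^ 3 :=
          mul_le_mul_of_nonneg_right h (by positivity)
        nlinarith [pow_nonneg (sq_nonneg y) 2]
    · rw [Set.indicator_of_notMem hx]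
      have h6 : |y| ≤ 1 / 2 := not_lt.1 hx
      have h7 : y ^ 2 ≤ 1 / 4 := by
        rw [← sq_abs]; nlinarith [abs_nonneg y]
      have h8 : (y ^ 2) ^ 2 * y ^ 2 ≤ (y ^ 2) ^ 2 * (1 / 4) :=
        mul_le_mul_of_nonneg_left h7 (by positivity)
      nlinarith [pow_nonneg (sq_nonneg y) 4]
  have h_mono := integral_mono ((integrable_rowSum_pow hβ 6).sub
    ((integrable_rowSum_pow hβ 4).div_const 4)) (((integrable_rowSum_pow hβ 8).const_mul (1 / 50)).add
      ((integrable_const ((50 : ℝ) ^ 3)).indicator hAm)) hpt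
  simp only [Pi.add_apply, Pi.sub_apply] at h_mono
  rw [integral_sub (integrable_rowSum_pow hβ 6) ((integrable_rowSum_pow hβ 4).div_const 4),
    integral_add ((integrable_rowSum_pow hβ 8).const_mul (1 / 50))
      ((integrable_const ((50 : ℝ) ^ 3)).indicator hAm), integral_div, integral_const_mul,
    integral_indicator_const _ hAm, m4, m6, smul_eq_mul] at h_mono
  have h9 : V ^ 4 ≤ 1 := pow_le_one₀ (by linarith) hv2
  have hlow : 3 / 10 ^ 4 ≤ 5 * V ^ 3 / 576 - V * K / 96 - V ^ 2 / 192 + K / 480 := by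
    have h10 : 0 ≤ (35 / 100 * V - K) * (V / 96 - 1 / 480) :=
      mul_nonneg (by linarith) (by linarith)
    have h11 : 0 ≤ (V - 98 / 100) ^ 2 := sq_nonneg _
    nlinarith [mul_nonneg (by linarith : (0 : ℝ) ≤ V - 98 / 100) (by linarith : (0 : ℝ) ≤ 1 - V),
      mul_nonneg (by linarith : (0 : ℝ) ≤ V) h11]
  nlinarith

end Moments

section Rows
open MeasureTheory ProbabilityTheory
open scoped Classical ENNReal Topology

/-- A Paley–Zygmund bound for centred linear forms. -/
theorem one_div_le_measureReal_rowSum {α : ℕ → ℝ} (hα : Summable fun j => |α j|) {ρ : ℝ}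
    (hρ0 : 0 ≤ ρ) (hρ : ρ ^ 2 = ∑' j, α j ^ 2) :
    1 / 400 ≤ cubeMeasure.real {x | 27 / 100 * ρ ≤ rowSum α x} := by
  obtain ⟨m2, m4, -, -⟩ := rowSum_moments hα
  have hK : 0 ≤ ∑' j, α j ^ 4 := tsum_nonneg fun j => by positivity
  rw [← hρ] at m2 m4
  rcases hρ0.eq_or_lt with h0 | hpos
  · have hz : ∀ j, α j = 0 := by
      intro j
      rw [← h0] at hρ
      have h1 := (summable_pow_of_summable_abs hα 1).le_tsum j fun i _ => sq_nonneg _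
      norm_num at h1 hρ
      nlinarith [sq_nonneg (α j)]
    have : {x | 27 / 100 * ρ ≤ rowSum α x} = Set.univ := by
      ext x; simp [rowSum, hz, ← h0]
    rw [this, probReal_univ]; norm_num
  set A : Set (ℕ → ℝ) := {x | 27 / 100 * ρ ≤ |rowSum α x|} with hA
  have hAm : MeasurableSet A := measurableSet_le measurable_const (measurable_rowSum α).abs
  have hPA : cubeMeasure.real A ≤ 2 * cubeMeasure.real {x | 27 / 100 * ρ ≤ rowSum α x} := by
    have h1 : A ⊆ {x | 27 / 100 * ρ ≤ rowSum α x} ∪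
        {x | -rowSum α x ∈ Set.Ici (27 / 100 * ρ)} := by
      intro x hx
      have hx' : 27 / 100 * ρ ≤ |rowSum α x| := hx
      rcases le_abs.1 hx' with h | h
      · exact Or.inl h
      · exact Or.inr h
    refine (measureReal_mono h1).trans ((measureReal_union_le _ _).trans ?_)
    rw [measureReal_abs_rowSum measurableSet_Ici]
    have h4 : {x | rowSum α x ∈ Set.Ici (27 / 100 * ρ)} = {x | 27 / 100 * ρ ≤ rowSum α x} := rfl
    rw [h4, two_mul]
  have hpt : ∀ x, rowSum α x ^ 2 ≤ (27 / 100 * ρ) ^ 2 + (1 / (4 * ρ ^ 2)) * rowSum α x ^ 4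
      + A.indicator (fun _ => ρ ^ 2) x := by
    intro x
    set y := rowSum α x
    by_cases hx : x ∈ A
    · rw [Set.indicator_of_mem hx]
      have h1 : y ^ 2 ≤ (1 / (4 * ρ ^ 2)) * y ^ 4 + ρ ^ 2 := by
        have h2 : (1 / (4 * ρ ^ 2)) * y ^ 4 + ρ ^ 2 - y ^ 2 = (y ^ 2 / (2 * ρ) - ρ) ^ 2 := by
          field_simp; ring
        nlinarith [sq_nonneg (y ^ 2 / (2 * ρ) - ρ)]
      nlinarith [sq_nonneg (27 / 100 * ρ)]
    · rw [Set.indicator_of_notMem hx]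
      have h1 : |y| ≤ 27 / 100 * ρ := (not_le.1 hx).le
      have h2 : y ^ 2 ≤ (27 / 100 * ρ) ^ 2 := by
        rw [← sq_abs]; exact pow_le_pow_left₀ (abs_nonneg _) h1 2
      have : 0 ≤ (1 / (4 * ρ ^ 2)) * y ^ 4 := by positivity
      linarith
  have hi4 := (integrable_rowSum_pow hα 4).const_mul (1 / (4 * ρ ^ 2))
  have hi0 : Integrable (fun x => (27 / 100 * ρ) ^ 2 + 1 / (4 * ρ ^ 2) * rowSum α x ^ 4)
      cubeMeasure := (integrable_const _).add hi4
  have h_mono := integral_mono (integrable_rowSum_pow hα 2) (hi0.add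
      ((integrable_const (ρ ^ 2)).indicator hAm)) hpt
  simp only [Pi.add_apply] at h_mono
  rw [integral_add hi0
      ((integrable_const (ρ ^ 2)).indicator hAm), integral_add (integrable_const _) hi4,
    integral_const_mul, integral_indicator_const _ hAm, m2, m4, smul_eq_mul, integral_const,
    probReal_univ, one_smul] at h_mono
  have h5 : 1 / (4 * ρ ^ 2) * ((ρ ^ 2) ^ 2 / 48 - (∑' j, α j ^ 4) / 120) ≤ ρ ^ 2 / 192 := by
    have h6 : 1 / (4 * ρ ^ 2) * ((ρ ^ 2) ^ 2 / 48 - (∑' j, α j ^ 4) / 120)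
        = ρ ^ 2 / 192 - 1 / (4 * ρ ^ 2) * ((∑' j, α j ^ 4) / 120) := by
      field_simp; ring
    have : 0 ≤ 1 / (4 * ρ ^ 2) * ((∑' j, α j ^ 4) / 120) := by positivity
    linarith
  have h7 : ρ ^ 2 * (1 / 12 - (27 / 100) ^ 2 - 1 / 192) ≤ ρ ^ 2 * cubeMeasure.real A := by
    nlinarith
  have h8 := le_of_mul_le_mul_left h7 (by positivity)
  norm_num at h8 ⊢
  linarith

theorem measurableSet_coord {S : Set ℝ} (hS : MeasurableSet S) (j : ℕ) :
    MeasurableSet {x : ℕ → ℝ | x j ∈ S} := measurable_pi_apply j hS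

/-- An event depending on one coordinate is independent of one not depending on it. -/
theorem measureReal_inter_coord {S : Set ℝ} (hS : MeasurableSet S) {σ : ℕ} {E : Set (ℕ → ℝ)}
    (hEm : MeasurableSet E) (hE : ∀ z, glue {σ} z ∈ E ↔ z.1 ∈ E) :
    cubeMeasure.real ({x | x σ ∈ S} ∩ E) = cubeMeasure.real {x | x σ ∈ S} * cubeMeasure.real E := by
  have h1 := (measurePreserving_glue {σ}).measure_preimage
    ((measurableSet_coord hS σ).inter hEm).nullMeasurableSet
  have h2 : glue {σ} ⁻¹' ({x | x σ ∈ S} ∩ E) = E ×ˢ {x | x σ ∈ S} := by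
    ext z
    simp only [Set.mem_preimage, Set.mem_inter_iff, Set.mem_ofPred_eq, hE, Set.mem_prod, glue,
      Set.mem_singleton_iff, if_true]
    exact and_comm
  rw [h2, Measure.prod_prod] at h1
  rw [measureReal_def, ← h1, ENNReal.toReal_mul, mul_comm]
  rfl

theorem measureReal_coord_ge {S : Set ℝ} (hS : MeasurableSet S) (σ : ℕ) {l u : ℝ} (hl : 0 ≤ l)
    (hu : u ≤ 1) (h : Set.Ioo l u ⊆ S) : u - l ≤ cubeMeasure.real {x | x σ ∈ S} := by
  have hmp := measurePreserving_eval_infinitePi (fun _ : ℕ => unitMeasure) σ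
  have h1 : cubeMeasure {x | x σ ∈ S} = unitMeasure S := hmp.measure_preimage hS.nullMeasurableSet
  have h2 : ENNReal.ofReal (u - l) ≤ unitMeasure S := by
    rw [← Real.volume_Ioo, unitMeasure_apply hS]
    exact measure_mono fun x hx => ⟨h hx, by linarith [hx.1], by linarith [hx.2]⟩
  rw [measureReal_def, h1]
  exact (ENNReal.ofReal_le_iff_le_toReal (measure_ne_top _ _)).1 h2

theorem rowSum_eq_add {α : ℕ → ℝ} (hα : Summable fun j => |α j|) (σ : ℕ) {x : ℕ → ℝ}
    (hx : x ∈ cube) :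
    rowSum α x = α σ * (x σ - 1 / 2) + rowSum (fun j => if j = σ then 0 else α j) x := by
  rw [rowSum, (summable_rowTerm hα hx).tsum_eq_add_tsum_ite σ, rowSum]
  simp only [ite_mul, zero_mul]

/-- The variance of a row with a dominating coefficient. -/
theorem variance_bound {m ρ w : ℝ} (hm : 35 / 100 ≤ m ^ 2) (hm0 : 0 ≤ m) (hρ : 0 ≤ ρ) (hw0 : 0 ≤ w)
    (hw : w ≤ 35 / 10 ^ 4) (h : m - 1 + 54 / 100 * ρ ≤ 2 * m * w) :
    m ^ 2 + ρ ^ 2 + 1 / 10 * ρ ^ 2 ≤ 1 + 50 * w := by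
  have hm1 : 59 / 100 ≤ m := by nlinarith
  have hm2 : m ≤ 101 / 100 := by nlinarith
  have hu : ρ ^ 2 * (54 / 100) ^ 2 ≤ (1 - m + 2 * m * w) ^ 2 := by
    rw [← mul_pow]
    exact pow_le_pow_left₀ (by positivity) (by linarith) 2
  have hmw : 0 ≤ m * w := mul_nonneg hm0 hw0
  have h1 : (1 - m + 2 * m * w) ^ 2 ≤ (1 - m) ^ 2 + 18 / 10 * w := by
    have h2 : (1 - m + 2 * m * w) ^ 2 = (1 - m) ^ 2 + w * (4 * m * (1 - m) + 4 * m ^ 2 * w) := by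
      ring
    have h3 : 4 * m * (1 - m) + 4 * m ^ 2 * w ≤ 18 / 10 := by
      have : m ^ 2 * w ≤ 2 * (35 / 10 ^ 4) :=
        mul_le_mul (by nlinarith) hw hw0 (by norm_num)
      nlinarith [sq_nonneg (m - 1 / 2)]
    rw [h2]; nlinarith [mul_le_mul_of_nonneg_left h3 hw0]
  have h4 : (11 / 10) / (54 / 100) ^ 2 * (1 - m) ^ 2 ≤ (1 - m) * (1 + m) + 10 * w := by
    rcases le_total m 1 with h5 | h5
    · have h6 : (11 / 10) / (54 / 100) ^ 2 * (1 - m) ≤ 1 + m := by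
        norm_num; nlinarith
      nlinarith [mul_le_mul_of_nonneg_left h6 (by linarith : (0 : ℝ) ≤ 1 - m)]
    · have h6 : m - 1 ≤ 3 * w := by nlinarith
      norm_num
      nlinarith
  norm_num at h4 hu
  nlinarith

/-- A row with a dominating coefficient, whose linear form is bounded by `1 / 2` on `B`, produces
an event outside `B` whose probability controls the excess of the variance over one. -/
theorem exists_bad_event {α : ℕ → ℝ} (hα : Summable fun j => |α j|) {σ : ℕ}
    (hσ : 35 / 100 ≤ α σ ^ 2) {d : ℝ} {B : Set (ℕ → ℝ)} (hBc : B ⊆ cube)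
    (hB : ∀ x ∈ B, |rowSum α x + d| ≤ 1 / 2) :
    ∃ S : Set ℝ, MeasurableSet S ∧ ∃ G : Set (ℕ → ℝ), MeasurableSet G ∧ G ⊆ {x | x σ ∈ S} ∧
      G ⊆ Bᶜ ∧ 1 / 400 * cubeMeasure.real {x | x σ ∈ S} ≤ cubeMeasure.real G ∧
      (cubeMeasure.real {x | x σ ∈ S} ≤ 35 / 10 ^ 4 →
        ∑' j, α j ^ 2 + 1 / 10 * (∑' j, α j ^ 2 - α σ ^ 2)
          ≤ 1 + 50 * cubeMeasure.real {x | x σ ∈ S}) := by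
  obtain ⟨τ, hτ, hτd⟩ : ∃ τ : ℝ, (τ = 1 ∨ τ = -1) ∧ 0 ≤ τ * d := by
    rcases le_total 0 d with h | h
    · exact ⟨1, Or.inl rfl, by linarith⟩
    · exact ⟨-1, Or.inr rfl, by linarith⟩
  have hτ2 : τ ^ 2 = 1 := by rcases hτ with h | h <;> rw [h] <;> norm_num
  set β : ℕ → ℝ := fun j => τ * (if j = σ then 0 else α j) with hβd
  have hβ : Summable fun j => |β j| := by
    refine Summable.of_nonneg_of_le (fun j => abs_nonneg _) (fun j => ?_) hα
    simp only [hβd, abs_mul]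
    have : |τ| = 1 := by rcases hτ with h | h <;> rw [h] <;> norm_num
    rw [this, one_mul]
    split_ifs
    · simp
    · exact le_rfl
  have hsq : Summable fun j => α j ^ 2 := summable_pow_of_summable_abs hα 1
  have hV : ∑' j, α j ^ 2 = α σ ^ 2 + ∑' j, β j ^ 2 := by
    rw [hsq.tsum_eq_add_tsum_ite σ]
    congr 1
    refine tsum_congr fun j => ?_
    simp only [hβd, mul_pow, hτ2, one_mul]
    split_ifs <;> simp
  set ρ := Real.sqrt (∑' j, β j ^ 2) with hρ
  have hρ0 : 0 ≤ ρ := Real.sqrt_nonneg _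
  have hρ2 : ρ ^ 2 = ∑' j, β j ^ 2 := Real.sq_sqrt (tsum_nonneg fun j => sq_nonneg _)
  have hrow : ∀ x ∈ cube, τ * rowSum α x = τ * α σ * (x σ - 1 / 2) + rowSum β x := by
    intro x hx
    rw [rowSum_eq_add hα σ hx, mul_add, ← mul_assoc]
    congr 1
    simp only [rowSum, hβd, mul_assoc]
    rw [tsum_mul_left]
  set S : Set ℝ := {u | 1 / 2 - 27 / 100 * ρ < τ * α σ * (u - 1 / 2)} with hS
  have hSm : MeasurableSet S := measurableSet_lt measurable_const (by fun_prop)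
  set E : Set (ℕ → ℝ) := {x | 27 / 100 * ρ ≤ rowSum β x} with hE
  have hEm : MeasurableSet E := measurableSet_le measurable_const (measurable_rowSum β)
  have hEglue : ∀ z, glue {σ} z ∈ E ↔ z.1 ∈ E := by
    intro z
    have : rowSum β (glue {σ} z) = rowSum β z.1 := by
      refine tsum_congr fun j => ?_
      by_cases hj : j = σ
      · simp [hβd, hj]
      · simp [glue, hj]
    simp only [hE, Set.mem_ofPred_eq, this]
  refine ⟨S, hSm, {x | x σ ∈ S} ∩ E, (measurableSet_coord hSm σ).inter hEm, Set.inter_subset_left,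
    ?_, ?_, ?_⟩
  · rintro x ⟨hxS, hxE⟩ hxB
    have h1 := hB x hxB
    have h2 := hrow x (hBc hxB)
    rw [abs_le] at h1
    simp only [hS, hE, Set.mem_ofPred_eq] at hxS hxE
    rcases hτ with h | h <;> rw [h] at h2 hτd hxS <;> linarith [h1.1, h1.2]
  · rw [measureReal_inter_coord hSm hEm hEglue, mul_comm]
    exact mul_le_mul_of_nonneg_left (one_div_le_measureReal_rowSum hβ hρ0 hρ2) measureReal_nonneg
  · intro hw
    set w := cubeMeasure.real {x | x σ ∈ S}
    have hm : 0 < |α σ| := by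
      rw [abs_pos]; intro h; rw [h] at hσ; norm_num at hσ
    have hcase : τ * α σ = |α σ| ∨ τ * α σ = -|α σ| := by
      rcases hτ with h | h <;> rcases abs_choice (α σ) with h' | h' <;> rw [h, h'] <;> simp
    have hy : |α σ| - 1 + 54 / 100 * ρ ≤ 2 * |α σ| * w := by
      set m := |α σ|
      set ℓ := (m - 1 + 54 / 100 * ρ) / (2 * m) with hℓ
      have hℓm : ℓ * (2 * m) = m - 1 + 54 / 100 * ρ := div_mul_cancel₀ _ (by positivity)
      have hlen : min ℓ 1 ≤ w := by
        rcases hcase with h | h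
        · have h1 := measureReal_coord_ge hSm σ (l := 1 - min ℓ 1) (u := 1)
            (by linarith [min_le_right ℓ 1]) le_rfl (fun u hu => by
              simp only [hS, Set.mem_ofPred_eq, h]
              nlinarith [hu.1, min_le_left ℓ 1])
          linarith
        · have h1 := measureReal_coord_ge hSm σ (l := 0) (u := min ℓ 1) le_rfl
            (min_le_right ℓ 1) (fun u hu => by
              simp only [hS, Set.mem_ofPred_eq, h]
              nlinarith [hu.2, min_le_left ℓ 1])
          linarith
      have hℓw : ℓ ≤ w := by
        rcases min_le_iff.1 hlen with h | h
        · exact h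
        · linarith
      nlinarith
    have h := variance_bound (by rwa [sq_abs]) hm.le hρ0 measureReal_nonneg hw hy
    rw [sq_abs] at h
    rw [hV, ← hρ2]
    linarith

end Rows

section BadEvents
open MeasureTheory ProbabilityTheory
open scoped Classical ENNReal Topology

theorem integral_indicator_one' {E : Set (ℕ → ℝ)} (hE : MeasurableSet E) :
    ∫ x, E.indicator (fun _ => (1 : ℝ)) x ∂cubeMeasure = cubeMeasure.real E := by
  rw [integral_indicator_const _ hE, smul_eq_mul, mul_one]

theorem sum_measureReal_coord_le_one {ι : Type*} (I : Finset ι) {σ : ι → ℕ} (hσ : Set.InjOn σ I)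
    {S : ι → Set ℝ} (hS : ∀ i, MeasurableSet (S i)) {G : ι → Set (ℕ → ℝ)}
    (hG : ∀ i, MeasurableSet (G i)) (hGS : ∀ i, G i ⊆ {x | x (σ i) ∈ S i}) {B : Set (ℕ → ℝ)}
    (hBm : MeasurableSet B) (hGB : ∀ i, G i ⊆ Bᶜ)
    (hGP : ∀ i, 1 / 400 * cubeMeasure.real {x | x (σ i) ∈ S i} ≤ cubeMeasure.real (G i))
    (hB : cubeMeasure.real Bᶜ ≤ 1 / 10 ^ 10) :
    ∑ i ∈ I, cubeMeasure.real {x | x (σ i) ∈ S i} ≤ 1 := by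
  set H : ι → Set (ℕ → ℝ) := fun i => {x | x (σ i) ∈ S i} with hH
  have hHm : ∀ i, MeasurableSet (H i) := fun i => measurableSet_coord (hS i) _
  set W := ∑ i ∈ I, cubeMeasure.real (H i) with hW
  by_contra! hW1
  set X : (ℕ → ℝ) → ℝ := fun x => ∑ i ∈ I, (H i).indicator (fun _ => (1 : ℝ)) x with hX
  have hX2 : ∀ x, X x ^ 2 = ∑ i ∈ I, ∑ k ∈ I, (H i ∩ H k).indicator (fun _ => (1 : ℝ)) x := by
    intro x
    rw [sq, hX, Finset.sum_mul_sum]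
    refine Finset.sum_congr rfl fun i _ => Finset.sum_congr rfl fun k _ => ?_
    rw [← Set.inter_indicator_mul, one_mul]
  have h_ind : ∀ E : Set (ℕ → ℝ), MeasurableSet E →
      Integrable (E.indicator fun _ => (1 : ℝ)) cubeMeasure := fun E hE =>
    (integrable_const _).indicator hE
  have hX2i : Integrable (fun x => X x ^ 2) cubeMeasure := by
    simp only [hX2]
    exact integrable_finsetSum _ fun i _ => integrable_finsetSum _ fun k _ =>
      h_ind _ ((hHm i).inter (hHm k))
  have hindep : ∀ i ∈ I, ∀ k ∈ I, i ≠ k →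
      cubeMeasure.real (H i ∩ H k) = cubeMeasure.real (H i) * cubeMeasure.real (H k) := by
    intro i hi k hk hik
    refine measureReal_inter_coord (hS i) (hHm k) fun z => ?_
    have : σ k ≠ σ i := fun h => hik (hσ hk hi h).symm
    simp [hH, glue, this]
  have hEX2 : ∫ x, X x ^ 2 ∂cubeMeasure ≤ W + W ^ 2 := by
    simp only [hX2]
    rw [integral_finsetSum _ fun i _ => integrable_finsetSum _ fun k _ =>
      h_ind _ ((hHm i).inter (hHm k))]
    have h1 : ∀ i ∈ I, ∫ x, ∑ k ∈ I, (H i ∩ H k).indicator (fun _ => (1 : ℝ)) x ∂cubeMeasure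
        ≤ cubeMeasure.real (H i) + cubeMeasure.real (H i) * W := by
      intro i hi
      rw [integral_finsetSum _ fun k _ => h_ind _ ((hHm i).inter (hHm k)),
        ← Finset.add_sum_erase _ _ hi, integral_indicator_one' ((hHm i).inter (hHm i)),
        Set.inter_self]
      gcongr
      rw [hW, Finset.mul_sum, ← Finset.add_sum_erase _ _ hi]
      refine le_add_of_nonneg_of_le (by positivity) (Finset.sum_le_sum fun k hk => ?_)
      rw [integral_indicator_one' ((hHm i).inter (hHm k)),
        hindep i hi k (Finset.mem_of_mem_erase hk) (Finset.ne_of_mem_erase hk).symm]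
    refine (Finset.sum_le_sum h1).trans ?_
    rw [Finset.sum_add_distrib, ← Finset.sum_mul, sq]
  set l : ℝ := 1 / (800 * W) with hl
  have hW0 : 0 < W := by linarith
  have hl0 : 0 < l := by positivity
  have hpt : ∀ x, ∑ i ∈ I, (G i).indicator (fun _ => (1 : ℝ)) x
      ≤ l / 2 * X x ^ 2 + 1 / (2 * l) * (Bᶜ).indicator (fun _ => (1 : ℝ)) x := by
    intro x
    by_cases hx : x ∈ B
    · have h1 : ∑ i ∈ I, (G i).indicator (fun _ => (1 : ℝ)) x = 0 :=
        Finset.sum_eq_zero fun i _ => Set.indicator_of_notMem (fun h => hGB i h hx) _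
      rw [h1]
      have h2 : 0 ≤ (Bᶜ).indicator (fun _ => (1 : ℝ)) x :=
        Set.indicator_nonneg (fun _ _ => zero_le_one) _
      positivity
    · rw [Set.indicator_of_mem (s := Bᶜ) hx]
      have h1 : ∑ i ∈ I, (G i).indicator (fun _ => (1 : ℝ)) x ≤ X x :=
        Finset.sum_le_sum fun i _ => Set.indicator_le_indicator_of_subset (hGS i)
          (fun _ => zero_le_one) x
      have h2 : l / 2 * X x ^ 2 + 1 / (2 * l) * 1 - X x = (l * X x - 1) ^ 2 / (2 * l) := by
        field_simp; ring
      have h3 : 0 ≤ (l * X x - 1) ^ 2 / (2 * l) := by positivity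
      linarith
  have h_mono := integral_mono (integrable_finsetSum I fun i _ => h_ind _ (hG i))
    ((hX2i.const_mul (l / 2)).add ((h_ind _ hBm.compl).const_mul (1 / (2 * l)))) hpt
  simp only [Pi.add_apply] at h_mono
  rw [integral_finsetSum _ fun i _ => h_ind _ (hG i), integral_add (hX2i.const_mul (l / 2))
    ((h_ind _ hBm.compl).const_mul (1 / (2 * l))), integral_const_mul, integral_const_mul,
    integral_indicator_one' hBm.compl,
    Finset.sum_congr rfl fun i _ => integral_indicator_one' (hG i)] at h_mono
  have h1 : 1 / 400 * W ≤ ∑ i ∈ I, cubeMeasure.real (G i) := by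
    rw [hW, Finset.mul_sum]; exact Finset.sum_le_sum fun i _ => hGP i
  have h2 : l / 2 * ∫ x, X x ^ 2 ∂cubeMeasure ≤ l / 2 * (2 * W ^ 2) :=
    mul_le_mul_of_nonneg_left (by nlinarith) (by positivity)
  have h3 : 1 / (2 * l) * cubeMeasure.real Bᶜ ≤ 1 / (2 * l) * (1 / 10 ^ 10) :=
    mul_le_mul_of_nonneg_left hB (by positivity)
  have h4 : l / 2 * (2 * W ^ 2) = W / 800 := by rw [hl]; field_simp
  have h5 : 1 / (2 * l) = 400 * W := by rw [hl]; field_simp; norm_num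
  rw [h5] at h3 h_mono
  rw [h4] at h2
  linarith

end BadEvents

section RowData
open MeasureTheory
open scoped Classical ENNReal Topology

theorem exists_summable_majorant {ι : Type*} {σ : ι → ℕ} {w : ι → ℝ} {c : ℝ} (hc : 0 ≤ c)
    (hw0 : ∀ i, 0 ≤ w i) (hwc : ∀ i, w i ≤ c)
    (hsum : ∀ I : Finset ι, Set.InjOn σ I → ∑ i ∈ I, w i ≤ 1) :
    ∃ W : ℕ → ℝ, (∀ j, 0 ≤ W j) ∧ Summable W ∧ (∀ j, W j ≤ c) ∧ ∀ i, w i ≤ W (σ i) := by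
  set W : ℕ → ℝ := fun j => ⨆ i, if σ i = j then w i else 0 with hW
  have hle : ∀ i j, (if σ i = j then w i else 0) ≤ c := fun i j => by split_ifs <;> simp [hwc, hc]
  have hbdd : ∀ j, BddAbove (Set.range fun i => if σ i = j then w i else 0) := fun j =>
    ⟨c, by rintro _ ⟨i, rfl⟩; exact hle i j⟩
  have hW0 : ∀ j, 0 ≤ W j := fun j => Real.iSup_nonneg fun i => by split_ifs <;> simp [hw0]
  refine ⟨W, hW0, ?_, fun j => Real.iSup_le (fun i => hle i j) hc, fun i => ?_⟩
  · refine summable_of_sum_le (c := 2) hW0 fun F => ?_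
    rcases isEmpty_or_nonempty ι with hι | hι
    · have : ∀ j, W j = 0 := fun j => Real.iSup_of_isEmpty _
      simp [this]
    have hch : ∀ j, ∃ i, 0 < W j → σ i = j ∧ W j / 2 ≤ w i := by
      intro j
      by_cases hj : 0 < W j
      · obtain ⟨i, hi⟩ := exists_lt_of_lt_ciSup (show W j / 2 < ⨆ i, if σ i = j then w i else 0 from
          half_lt_self hj)
        refine ⟨i, fun _ => ?_⟩
        split_ifs at hi with h
        · exact ⟨h, hi.le⟩
        · linarith
      · exact ⟨Classical.arbitrary ι, fun h => absurd h hj⟩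
    choose s hs using hch
    rw [← Finset.sum_filter_add_sum_filter_not F (fun j => 0 < W j),
      Finset.sum_eq_zero (s := F.filter fun j => ¬ 0 < W j) fun j hj =>
        le_antisymm (not_lt.1 (Finset.mem_filter.1 hj).2) (hW0 j), add_zero]
    have hinj : Set.InjOn s (F.filter fun j => 0 < W j) := by
      intro i hi j hj hij
      rw [Finset.mem_coe, Finset.mem_filter] at hi hj
      rw [← (hs i hi.2).1, ← (hs j hj.2).1, hij]
    have h1 := hsum ((F.filter fun j => 0 < W j).image s) (by
      intro x hx y hy hxy
      rw [Finset.coe_image] at hx hy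
      obtain ⟨i, hi, rfl⟩ := hx
      obtain ⟨j, hj, rfl⟩ := hy
      rw [Finset.mem_coe, Finset.mem_filter] at hi hj
      rw [(hs i hi.2).1, (hs j hj.2).1] at hxy
      rw [hxy])
    rw [Finset.sum_image hinj] at h1
    calc ∑ j ∈ F.filter fun j => 0 < W j, W j
        ≤ ∑ j ∈ F.filter fun j => 0 < W j, 2 * w (s j) := Finset.sum_le_sum fun j hj => by
          linarith [(hs j (Finset.mem_filter.1 hj).2).2]
      _ ≤ 2 := by rw [← Finset.mul_sum]; linarith
  · have := le_ciSup (hbdd (σ i)) i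
    simpa using this

theorem rowSum_neg (α : ℕ → ℝ) (x : ℕ → ℝ) : rowSum (fun j => -α j) x = -rowSum α x := by
  simp only [rowSum, neg_mul, tsum_neg]

theorem exists_large_coeff_of_mem_Icc {α : ℕ → ℝ} (hα : Summable fun j => |α j|)
    (hv : 98 / 100 ≤ ∑' j, α j ^ 2) {d : ℝ} {B : Set (ℕ → ℝ)}
    (hB : ∀ x ∈ B, |rowSum α x + d| ≤ 1 / 2) (hBP : cubeMeasure.real Bᶜ ≤ 1 / 10 ^ 10) :
    ∃ j, 35 / 100 ≤ α j ^ 2 := by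
  rcases le_total 0 d with hd | hd
  · refine exists_large_coeff hα hv ((measureReal_mono fun x hx hxB => ?_).trans hBP)
    have hx' : 1 / 2 < rowSum α x := hx
    have := (abs_le.1 (hB x hxB)).2
    linarith
  · have := exists_large_coeff (α := fun j => -α j) (by simpa using hα) (by simpa using hv)
      ((measureReal_mono fun x hx hxB => ?_).trans hBP)
    · simpa using this
    · have hx' : 1 / 2 < rowSum (fun j => -α j) x := hx
      rw [rowSum_neg] at hx'
      have := (abs_le.1 (hB x hxB)).1
      linarith

/-- Almost all of the cube being mapped to the cube by an affine map with coefficients `α i j`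
forces every row of large variance to be dominated by one coefficient, with summable defects. -/
theorem exists_row_defects {α : ℕ → ℕ → ℝ} (hα : ∀ i, Summable fun j => |α i j|) {d : ℕ → ℝ}
    {B : Set (ℕ → ℝ)} (hBm : MeasurableSet B) (hBc : B ⊆ cube)
    (hB : ∀ x ∈ B, ∀ i, |rowSum (α i) x + d i| ≤ 1 / 2)
    (hBP : cubeMeasure.real Bᶜ ≤ 1 / 10 ^ 10) :
    ∃ D : ℕ → ℝ, (∀ j, 0 ≤ D j) ∧ Summable D ∧ (∀ j, D j ≤ 35 / 200) ∧
      ∀ i, ∑' j, α i j ^ 2 < 98 / 100 ∨ ∃ s, 35 / 100 ≤ α i s ^ 2 ∧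
        ∑' j, α i j ^ 2 + 1 / 10 * (∑' j, α i j ^ 2 - α i s ^ 2) ≤ 1 + D s := by
  have h1 : ∀ i : {i // 98 / 100 ≤ ∑' j, α i j ^ 2}, ∃ s, 35 / 100 ≤ α i s ^ 2 := fun i =>
    exists_large_coeff_of_mem_Icc (hα i) i.2 (fun x hx => hB x hx i) hBP
  choose σ hσ using h1
  have h2 := fun i : {i // 98 / 100 ≤ ∑' j, α i j ^ 2} =>
    exists_bad_event (hα i) (hσ i) hBc (fun x hx => hB x hx i)
  choose S hS G hG hGS hGB hGP hw using h2
  have hwle : ∀ i, cubeMeasure.real {x | x (σ i) ∈ S i} ≤ 35 / 10 ^ 4 := by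
    intro i
    have := (hGP i).trans ((measureReal_mono (hGB i)).trans hBP)
    linarith
  obtain ⟨W, hW0, hWs, hWc, hwW⟩ := exists_summable_majorant (σ := σ) (c := 35 / 10 ^ 4)
    (w := fun i => cubeMeasure.real {x | x (σ i) ∈ S i}) (by norm_num)
    (fun i => measureReal_nonneg) hwle
    (fun I hI => sum_measureReal_coord_le_one I hI hS hG hGS hBm hGB hGP hBP)
  refine ⟨fun j => 50 * W j, fun j => by have := hW0 j; positivity, hWs.mul_left 50,
    fun j => by linarith [hWc j], fun i => ?_⟩
  by_cases hi : 98 / 100 ≤ ∑' j, α i j ^ 2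
  · refine Or.inr ⟨σ ⟨i, hi⟩, hσ ⟨i, hi⟩, ?_⟩
    have h3 := hw ⟨i, hi⟩ (hwle _)
    have h4 := hwW ⟨i, hi⟩
    simp only at h3 h4
    linarith
  · exact Or.inl (not_le.1 hi)

end RowData

section Flow
open MeasureTheory
open scoped Classical ENNReal Topology

theorem summable_mul_of_mem_cube {α x : ℕ → ℝ} (hα : Summable fun j => |α j|) (hx : x ∈ cube) :
    Summable fun j => α j * x j := by
  refine Summable.of_norm_bounded hα fun j => ?_
  rw [Real.norm_eq_abs, abs_mul, abs_of_nonneg (hx j).1]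
  exact mul_le_of_le_one_right (abs_nonneg _) (hx j).2

/-- If an orthonormal system maps a closed set of positive measure of the cube into the cube, then
its coefficients admit exhausting finite sets of indices with arbitrarily small leakage. -/
theorem exists_small_leak {a : ℕ → ℝ} (ha : ∀ i, 0 < a i) (hsum : Summable fun i => (a i) ^ 2)
    {t : ℕ → Ell} (ht : Orthonormal ℝ t) {c : ℕ → ℝ} {B : Set (ℕ → ℝ)} (hBcl : IsClosed B)
    (hBc : B ⊆ cube) (hB0 : cubeMeasure B ≠ 0)
    (hB : ∀ x ∈ B, ∀ i, c i + ∑' j, (t j i * a j / a i) * x j ∈ Set.Icc (0 : ℝ) 1)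
    {η : ℝ} (hη : 0 < η) (n1 : ℕ) :
    ∃ N : Finset ℕ, Finset.range n1 ⊆ N ∧
      LevelData.dsum (fun i j => i ∉ N ∧ j ∈ N) (fun i j => t j i ^ 2) ≤ ENNReal.ofReal η := by
  obtain ⟨n0, q, δ, hδ, hqδ, hBd⟩ := exists_box_density hBcl hB0
    (ε := ENNReal.ofReal (1 / 10 ^ 10)) (by rw [ENNReal.ofReal_pos]; norm_num)
  set φ : (ℕ → ℝ) → ℕ → ℝ := fun x j => q j + δ j * x j with hφ
  have hφm : Measurable φ := by
    refine measurable_pi_lambda _ fun j => ?_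
    simp only [hφ]; fun_prop
  set B' : Set (ℕ → ℝ) := φ ⁻¹' B ∩ cube with hB'
  have hB'm : MeasurableSet B' := (hφm hBcl.measurableSet).inter measurableSet_cube
  have hB'P : cubeMeasure.real B'ᶜ ≤ 1 / 10 ^ 10 := by
    have h1 : cubeMeasure B' = cubeMeasure (φ ⁻¹' B) :=
      measure_congr (inter_ae_eq_left_of_ae_eq_univ (eventuallyEq_univ.2 ae_mem_cube))
    refine ENNReal.toReal_le_of_le_ofReal (by norm_num) ?_
    rw [prob_compl_eq_one_sub hB'm, h1]
    exact tsub_le_iff_left.2 (tsub_le_iff_right.1 hBd)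
  set A : ℕ → ℕ → ℝ := fun i j => t j i * a j / a i with hA
  have hAs : ∀ i, Summable fun j => |A i j| := row_summable_abs ha hsum ht
  set α : ℕ → ℕ → ℝ := fun i j => A i j * δ j with hα
  have hαs : ∀ i, Summable fun j => |α i j| := fun i => by
    refine (hAs i).of_nonneg_of_le (fun j => abs_nonneg _) fun j => ?_
    rw [hα]; simp only
    rw [abs_mul, abs_of_pos (hδ j).1]
    exact mul_le_of_le_one_right (abs_nonneg _) (hδ j).2
  obtain ⟨D, hD0, hDs, hDle, hD⟩ := exists_row_defects hαs
    (d := fun i => c i + ∑' j, A i j * (q j + δ j / 2) - 1 / 2) hB'm Set.inter_subset_right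
    (fun x hx i => by
      have h1 := hB _ hx.1 i
      have h2 : Summable fun j => A i j * φ x j := summable_mul_of_mem_cube (hAs i) (hBc hx.1)
      have h3 := summable_rowTerm (hαs i) hx.2
      have h4 : ∑' j, A i j * (q j + δ j / 2) = ∑' j, A i j * φ x j - rowSum (α i) x := by
        rw [rowSum, ← h2.tsum_sub h3]
        refine tsum_congr fun j => ?_
        simp only [hα, hφ]; ring
      rw [h4, abs_le]
      have h1' : c i + ∑' j, A i j * φ x j ∈ Set.Icc (0 : ℝ) 1 := h1
      constructor <;> linarith [h1'.1, h1'.2]) hB'P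
  have hkey : ∀ i j, t j i ^ 2 * (a j * δ j) ^ 2 = a i ^ 2 * α i j ^ 2 := fun i j => by
    have := (ha i).ne'
    simp only [hα, hA]; field_simp
  have hkeys : ∀ i, ∑' j, t j i ^ 2 * (a j * δ j) ^ 2 = a i ^ 2 * ∑' j, α i j ^ 2 := fun i => by
    rw [← tsum_mul_left]; exact tsum_congr (hkey i)
  have hrow : ∀ i, ∃ r, (r = 0 ∧ ∑' j, α i j ^ 2 < 98 / 100) ∨ ∃ s, r = D s ∧
      35 / 100 ≤ α i s ^ 2 ∧
        ∑' j, α i j ^ 2 + 1 / 10 * (∑' j, α i j ^ 2 - α i s ^ 2) ≤ 1 + D s := fun i => by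
    rcases hD i with h | ⟨s, hs⟩
    · exact ⟨0, Or.inl ⟨rfl, h⟩⟩
    · exact ⟨D s, Or.inr ⟨s, rfl, hs⟩⟩
  choose r hr using hrow
  have hle : ∀ i s, α i s ^ 2 ≤ ∑' j, α i j ^ 2 := fun i s =>
    (summable_pow_of_summable_abs (hαs i) 1).le_tsum s fun j _ => sq_nonneg _
  have H : LevelData (fun i j => t j i ^ 2) (fun j => (a j * δ j) ^ 2) (fun j => a j ^ 2)
      (fun i => 1 + r i - ∑' j, α i j ^ 2) D r n0 (35 / 100) 50 := by
    refine ⟨fun i j => sq_nonneg _, fun j => ?_, fun i => (row_bessel ht i).1,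
      fun i => (row_bessel ht i).2, fun j => ?_, fun j => ?_, fun j hj => ?_, hsum, hD0, hDs,
      fun i => ?_, by norm_num, by norm_num, fun j => ?_, fun i => ?_, fun i => ?_⟩
    · simpa [ht.1 j] using Ell.norm_sq (t j)
    · have := mul_pos (ha j) (hδ j).1
      positivity
    · have h1 : a j * δ j ≤ a j := mul_le_of_le_one_right (ha j).le (hδ j).2
      exact pow_le_pow_left₀ (mul_pos (ha j) (hδ j).1).le h1 2
    · simp [(hqδ j hj).2]
    · rcases hr i with ⟨h0, h⟩ | ⟨s, h0, h1, h2⟩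
      · rw [h0]; linarith
      · have := hle i s
        rw [h0]; linarith
    · linarith [hDle j]
    · rw [hkeys]; ring
    · rw [hkeys]
      rcases hr i with ⟨h0, h⟩ | ⟨s, h0, h1, h2⟩
      · refine Or.inl ⟨h0, ?_⟩
        rw [h0]; linarith
      · refine Or.inr ⟨s, h0, ?_, ?_⟩
        · simp only [hkey]
          nlinarith [sq_nonneg (a i)]
        · simp only [hkey]
          have := hle i s
          have h3 : ∑' j, α i j ^ 2 - α i s ^ 2 ≤ 50 * (1 + r i - ∑' j, α i j ^ 2) := by
            rw [h0]; linarith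
          nlinarith [sq_nonneg (a i), mul_le_mul_of_nonneg_left h3 (sq_nonneg (a i))]
  exact LevelData.exists_small_flow H hη n1

end Flow

section CylinderBound
open MeasureTheory
open scoped Classical ENNReal Topology

theorem sum_one_sub_le_of_dsum_le {p : ℕ → ℕ → ℝ} (hp : ∀ i j, 0 ≤ p i j)
    (hcol : ∀ j, HasSum (fun i => p i j) 1) {N : Finset ℕ} {η : ℝ} (hη : 0 ≤ η)
    (h : LevelData.dsum (fun i j => i ∉ N ∧ j ∈ N) p ≤ ENNReal.ofReal η) :
    ∑ j ∈ N, (1 - ∑ i ∈ N, p i j) ≤ η := by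
  have h1 : ∀ j, HasSum (fun i => if i ∉ N then p i j else 0) (1 - ∑ i ∈ N, p i j) := fun j => by
    have h2 : HasSum (fun i => if i ∈ N then p i j else 0) (∑ i ∈ N, if i ∈ N then p i j else 0) :=
      hasSum_sum_of_ne_finset_zero fun i hi => by simp [hi]
    rw [Finset.sum_congr rfl fun i hi => if_pos hi] at h2
    refine ((hcol j).sub h2).congr_fun ?_
    intro i
    by_cases hi : i ∈ N <;> simp [hi]
  have h0 : ∀ j, 0 ≤ 1 - ∑ i ∈ N, p i j := fun j =>
    (h1 j).nonneg fun i => by split_ifs <;> simp [hp]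
  rw [← ENNReal.ofReal_le_ofReal_iff hη, ENNReal.ofReal_sum_of_nonneg fun j _ => h0 j]
  refine le_trans ?_ h
  rw [LevelData.dsum, ENNReal.tsum_comm]
  refine le_trans (Finset.sum_le_sum fun j hj => ?_) (ENNReal.sum_le_tsum N)
  rw [← (h1 j).tsum_eq, ENNReal.ofReal_tsum_of_nonneg
    (fun i => by split_ifs <;> simp [hp]) (h1 j).summable]
  refine ENNReal.tsum_le_tsum fun i => ?_
  by_cases hi : i ∈ N <;> simp [hi, hj]

theorem Orthonormal.sum_mulVec_sq_le {t : ℕ → Ell} (ht : Orthonormal ℝ t) (N : Finset ℕ)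
    (x : N → ℝ) :
    ∑ i, ((Matrix.of fun i j : N => t j i).mulVec x i) ^ 2 ≤ ∑ i, x i ^ 2 := by
  set u : Ell := ∑ j : N, x j • t j with hu
  have h1 : ‖u‖ ^ 2 = ∑ i, x i ^ 2 := by
    have := (ht.comp _ Subtype.val_injective).inner_sum x x (Finset.univ : Finset N)
    rw [← real_inner_self_eq_norm_sq]
    simpa [hu, sq] using this
  have h2 : ∀ i : N, (Matrix.of fun i j : N => t j i).mulVec x i = u i := fun i => by
    rw [hu, lp.coeFn_sum, Finset.sum_apply, Matrix.mulVec, dotProduct]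
    refine Finset.sum_congr rfl fun j _ => ?_
    rw [lp.coeFn_smul, Pi.smul_apply, smul_eq_mul, Matrix.of_apply, mul_comm]
  have h3 := Ell.norm_sq u
  rw [← h1, Finset.sum_congr rfl fun i _ => by rw [h2 i], Finset.sum_coe_sort N fun i => u i ^ 2]
  exact sum_le_hasSum N (fun i _ => sq_nonneg _) h3

theorem det_conj_diagonal {a : ℕ → ℝ} (ha : ∀ i, 0 < a i) (T : ℕ → ℕ → ℝ) (N : Finset ℕ) :
    (Matrix.of fun i j : N => T i j * a j / a i).det = (Matrix.of fun i j : N => T i j).det := by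
  have h : (Matrix.of fun i j : N => T i j * a j / a i)
      = Matrix.diagonal (fun i : N => (a i)⁻¹) * (Matrix.of fun i j : N => T i j)
        * Matrix.diagonal (fun i : N => a i) := by
    ext i j
    simp only [Matrix.mul_diagonal, Matrix.diagonal_mul, Matrix.of_apply]
    ring
  rw [h, Matrix.det_mul, Matrix.det_mul, Matrix.det_diagonal, Matrix.det_diagonal,
    mul_right_comm, ← Finset.prod_mul_distrib,
    Finset.prod_eq_one fun (i : N) _ => inv_mul_cancel₀ (ha i).ne', one_mul]

theorem IsBCData.subset_cube {lo hi : ℕ → ℝ} (h : IsBCData lo hi) : cylSet lo hi ⊆ cube :=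
  fun _ hx i => ⟨(h.1 i).trans (hx i).1, (hx i).2.trans (h.2.2.1 i)⟩

theorem bcVol_eq_prod {lo hi : ℕ → ℝ} {N : Finset ℕ}
    (hN : ∀ i, i ∉ N → lo i = 0 ∧ hi i = 1) : bcVol lo hi = ∏ i ∈ N, (hi i - lo i) := by
  refine finprod_eq_prod_of_mulSupport_subset _ fun i hi' => ?_
  by_contra hiN
  exact hi' (by simp [hN i hiN])

theorem cubeMeasure_cylinder_le {a : ℕ → ℝ} (ha : ∀ i, 0 < a i)
    (hsum : Summable fun i => (a i) ^ 2) {lo hi : ℕ → ℝ} (h : IsBCData lo hi)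
    {f : (ℕ → ℝ) → ℕ → ℝ} (hf : IsIsomOn a f (cylSet lo hi)) :
    cubeMeasure (f '' cylSet lo hi ∩ cube) ≤ ENNReal.ofReal (bcVol lo hi) := by
  set B := f '' cylSet lo hi ∩ cube with hBdef
  by_cases hB0 : cubeMeasure B = 0
  · rw [hB0]; exact zero_le
  have hcube : IsClosed cube := (isCompact_cylSet (fun _ => 0) fun _ => 1).isClosed
  have hBcl : IsClosed B :=
    (isClosed_image ha hsum h.subset_cube (isCompact_cylSet lo hi) hf).inter hcube
  obtain ⟨t, ht, c, hc⟩ := exists_orthonormal_of_isIsomOn ha hsum h.subset_cube hf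
    hBcl.measurableSet Set.inter_subset_left Set.inter_subset_right hB0
  obtain ⟨n1, hn1⟩ := h.2.2.2.bddAbove
  have hP1 : cubeMeasure.real B ≤ 1 := measureReal_le_one
  have key : ∀ η : ℝ, 0 < η → η < 1 → cubeMeasure.real B * (1 - η) ≤ bcVol lo hi := by
    intro η hη hη1
    obtain ⟨N, hN, hflow⟩ := exists_small_leak ha hsum ht hBcl Set.inter_subset_right hB0
      (fun x hx i => ⟨(h.1 i).trans (hc x hx i).1, (hc x hx i).2.trans (h.2.2.1 i)⟩) hη (n1 + 1)
    have hleak := sum_one_sub_le_of_dsum_le (fun i j => sq_nonneg (t j i))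
      (fun j => by simpa [ht.1 j] using Ell.norm_sq (t j)) hη.le hflow
    have hdet := Matrix.one_sub_trace_le_det_gram _ (ht.sum_mulVec_sq_le N)
    simp only [Matrix.of_apply] at hdet
    rw [Finset.sum_coe_sort N fun j => 1 - ∑ i : N, t j i ^ 2,
      Finset.sum_congr rfl fun j _ => by rw [Finset.sum_coe_sort N fun i => t j i ^ 2]] at hdet
    have hvol := cubeMeasure_mul_det_le (row_summable_abs ha hsum ht) h.2.1 hBcl.measurableSet
      Set.inter_subset_right hc N
    rw [det_conj_diagonal ha (fun i j => t j i), ← bcVol_eq_prod fun i hi' => by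
      by_contra hne
      exact hi' (hN (Finset.mem_range.2 (Nat.lt_succ_of_le (hn1 hne))))] at hvol
    set Δ := (Matrix.of fun i j : N => t j i).det with hΔ
    have hV0 : 0 ≤ bcVol lo hi := finprod_nonneg fun i => sub_nonneg.2 (h.2.1 i)
    have hreal : cubeMeasure.real B * |Δ| ≤ bcVol lo hi := by
      have := ENNReal.toReal_mono ENNReal.ofReal_ne_top hvol
      rwa [ENNReal.toReal_mul, ENNReal.toReal_ofReal (abs_nonneg _), ENNReal.toReal_ofReal hV0]
        at this
    have hΔ1 : 1 - η ≤ |Δ| := by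
      by_contra hlt
      have h1 : Δ ^ 2 = |Δ| ^ 2 := (sq_abs Δ).symm
      nlinarith [abs_nonneg Δ]
    exact (mul_le_mul_of_nonneg_left hΔ1 measureReal_nonneg).trans hreal
  have hle : cubeMeasure.real B ≤ bcVol lo hi := by
    by_contra hlt
    have hV0 : 0 ≤ bcVol lo hi := finprod_nonneg fun i => sub_nonneg.2 (h.2.1 i)
    have := key ((cubeMeasure.real B - bcVol lo hi) / 2) (by linarith) (by linarith)
    nlinarith
  rw [← ofReal_measureReal]
  exact ENNReal.ofReal_le_ofReal hle

end CylinderBound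

section Main
open MeasureTheory
open scoped Classical ENNReal Topology

theorem one_le_preMu_cube {a : ℕ → ℝ} (ha : ∀ i, 0 < a i) (hsum : Summable fun i => (a i) ^ 2)
    (δ : ℝ) : 1 ≤ preMu a δ cube := by
  refine le_sInf ?_
  rintro _ ⟨K, v, hK, -, hcov, rfl⟩
  calc (1 : ℝ≥0∞) = cubeMeasure (⋃ n, K n ∩ cube) := by
        rw [← Set.iUnion_inter, Set.inter_eq_right.2 hcov, cubeMeasure_cube]
    _ ≤ ∑' n, cubeMeasure (K n ∩ cube) := measure_iUnion_le _
    _ ≤ ∑' n, ENNReal.ofReal (v n) := ENNReal.tsum_le_tsum fun n => by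
        obtain ⟨lo, hi, h, hv, f, hf, hfK⟩ := hK n
        rw [hv, ← hfK]
        exact cubeMeasure_cylinder_le ha hsum h hf

/-- Lower ends of the box with corner `L` in the first `N` coordinates. -/
def boxLo (N : ℕ) (L : ℕ → ℝ) (i : ℕ) : ℝ := if i < N then L i else 0

/-- Upper ends of the box with corner `L` and side `s` in the first `N` coordinates. -/
def boxHi (N : ℕ) (L : ℕ → ℝ) (s : ℝ) (i : ℕ) : ℝ := if i < N then L i + s else 1

theorem isCylVol_box (a : ℕ → ℝ) {N : ℕ} {L : ℕ → ℝ} {s : ℝ} (hs : 0 ≤ s)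
    (hL : ∀ i < N, 0 ≤ L i ∧ L i + s ≤ 1) :
    IsCylVol a (cylSet (boxLo N L) (boxHi N L s)) (s ^ N) := by
  refine ⟨boxLo N L, boxHi N L s, ⟨fun i => ?_, fun i => ?_, fun i => ?_, ?_⟩, ?_, id,
    fun _ _ _ _ => rfl, Set.image_id _⟩
  · unfold boxLo; split_ifs with h
    exacts [(hL i h).1, le_rfl]
  · unfold boxLo boxHi; split_ifs <;> linarith
  · unfold boxHi; split_ifs with h
    exacts [(hL i h).2, le_rfl]
  · refine (Set.finite_lt_nat N).subset fun i hi => ?_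
    by_contra h
    exact hi ⟨if_neg h, if_neg h⟩
  · rw [bcVol_eq_prod (N := Finset.range N) fun i hi => by
      rw [Finset.mem_range] at hi
      exact ⟨if_neg hi, if_neg hi⟩]
    rw [Finset.prod_congr rfl fun i hi => by
      rw [boxLo, boxHi, if_pos (Finset.mem_range.1 hi), if_pos (Finset.mem_range.1 hi),
        add_sub_cancel_left], Finset.prod_const, Finset.card_range]

theorem daDiam_box_le {a : ℕ → ℝ} (hsum : Summable fun i => (a i) ^ 2) (N : ℕ) (L : ℕ → ℝ)
    {s : ℝ} : daDiam a (cylSet (boxLo N L) (boxHi N L s))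
      ≤ Real.sqrt (s ^ 2 * ∑' i, a i ^ 2 + ∑' i, a (i + N) ^ 2) := by
  refine Real.sSup_le ?_ (Real.sqrt_nonneg _)
  rintro _ ⟨x, hx, y, hy, rfl⟩
  refine Real.sqrt_le_sqrt ?_
  have hhead : ∀ i, i < N → a i ^ 2 * (x i - y i) ^ 2 ≤ s ^ 2 * a i ^ 2 := fun i hi => by
    have h1 := hx i
    have h2 := hy i
    rw [boxLo, boxHi, if_pos hi, if_pos hi] at h1 h2
    have h3 : (x i - y i) ^ 2 ≤ s ^ 2 := sq_le_sq.2 (by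
      rw [abs_of_nonneg (a := s) (by linarith [h1.1, h1.2]), abs_le]
      constructor <;> linarith [h1.1, h1.2, h2.1, h2.2])
    nlinarith [sq_nonneg (a i)]
  have htail : ∀ i, ¬ i < N → a i ^ 2 * (x i - y i) ^ 2 ≤ a i ^ 2 := fun i hi => by
    have h1 := hx i
    have h2 := hy i
    rw [boxLo, boxHi, if_neg hi, if_neg hi] at h1 h2
    have h3 : (x i - y i) ^ 2 ≤ 1 := (sq_le_one_iff_abs_le_one _).2
      (abs_le.2 (by constructor <;> linarith [h1.1, h1.2, h2.1, h2.2]))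
    exact mul_le_of_le_one_right (sq_nonneg _) h3
  have hs : Summable fun i => a i ^ 2 * (x i - y i) ^ 2 := by
    refine Summable.of_nonneg_of_le (fun i => by positivity) (fun i => ?_)
      (hsum.add (hsum.mul_left (s ^ 2)))
    by_cases hi : i < N
    · exact (hhead i hi).trans (le_add_of_nonneg_left (sq_nonneg _))
    · exact (htail i hi).trans (le_add_of_nonneg_right (by positivity))
  rw [← hs.sum_add_tsum_nat_add N]
  refine add_le_add ?_ (((summable_nat_add_iff N).2 hs).tsum_le_tsum (fun i => htail _ (by omega))
    ((summable_nat_add_iff N).2 hsum))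
  calc ∑ i ∈ Finset.range N, a i ^ 2 * (x i - y i) ^ 2
      ≤ ∑ i ∈ Finset.range N, s ^ 2 * a i ^ 2 :=
        Finset.sum_le_sum fun i hi => hhead i (Finset.mem_range.1 hi)
    _ ≤ s ^ 2 * ∑' i, a i ^ 2 := by
        rw [← Finset.mul_sum]
        exact mul_le_mul_of_nonneg_left (hsum.sum_le_tsum _ fun i _ => sq_nonneg _) (sq_nonneg _)

theorem exists_fin_div_le {m : ℕ} (hm : 0 < m) {x : ℝ} (hx : x ∈ Set.Icc (0 : ℝ) 1) :
    ∃ k : Fin m, x ∈ Set.Icc ((k : ℝ) / m) ((k : ℝ) / m + 1 / m) := by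
  have hm' : (0 : ℝ) < m := by exact_mod_cast hm
  rcases hx.2.lt_or_eq with h | rfl
  · have h0 : 0 ≤ (m : ℝ) * x := mul_nonneg hm'.le hx.1
    have h1 : ⌊(m : ℝ) * x⌋₊ < m := (Nat.floor_lt h0).2 (mul_lt_of_lt_one_right hm' h)
    refine ⟨⟨_, h1⟩, ?_, ?_⟩
    · rw [div_le_iff₀ hm', mul_comm x]; exact Nat.floor_le h0
    · rw [← add_div, le_div_iff₀ hm', mul_comm x]; exact (Nat.lt_floor_add_one _).le
  · refine ⟨⟨m - 1, by omega⟩, ?_, ?_⟩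
    · rw [div_le_one hm']; exact_mod_cast Nat.sub_le m 1
    · rw [← add_div, le_div_iff₀ hm', one_mul]
      simp only
      exact_mod_cast (Nat.sub_add_cancel hm).ge

theorem preMu_cube_le_one {a : ℕ → ℝ} (hsum : Summable fun i => (a i) ^ 2) {δ : ℝ} (hδ : 0 < δ) :
    preMu a δ cube ≤ 1 := by
  obtain ⟨N, hN, hN0⟩ : ∃ N : ℕ, ∑' i, a (i + N) ^ 2 < δ ^ 2 / 2 ∧ 0 < N :=
    (((tendsto_sum_nat_add fun i => a i ^ 2).eventually_lt_const (by positivity)).and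
      (eventually_gt_atTop 0)).exists
  set C := ∑' i, a i ^ 2 with hC
  have hC0 : 0 ≤ C := tsum_nonneg fun i => sq_nonneg _
  obtain ⟨m, hm, hm0⟩ : ∃ m : ℕ, (1 / (m : ℝ)) ^ 2 * C < δ ^ 2 / 2 ∧ 0 < m := by
    have h1 : Tendsto (fun m : ℕ => (1 / (m : ℝ)) ^ 2 * C) atTop (𝓝 (0 ^ 2 * C)) :=
      (tendsto_one_div_atTop_nhds_zero_nat.pow 2).mul_const C
    exact ((h1.eventually_lt_const (by simp; positivity)).and (eventually_gt_atTop 0)).exists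
  have hm' : (0 : ℝ) < m := by exact_mod_cast hm0
  set L : ℕ → ℕ → ℝ := fun n i => if h : n < m ^ N ∧ i < N then
    ((finFunctionFinEquiv.symm ⟨n, h.1⟩ ⟨i, h.2⟩ : Fin m) : ℝ) / m else 0 with hL
  set s : ℕ → ℝ := fun n => if n < m ^ N then 1 / (m : ℝ) else 0 with hs
  have hs0 : ∀ n, 0 ≤ s n := fun n => by simp only [hs]; split_ifs <;> positivity
  have hsle : ∀ n, s n ≤ 1 / m := fun n => by
    simp only [hs]; split_ifs
    exacts [le_rfl, by positivity]
  refine sInf_le ⟨fun n => cylSet (boxLo N (L n)) (boxHi N (L n) (s n)), fun n => s n ^ N,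
    fun n => isCylVol_box a (hs0 n) fun i hi => ?_, fun n => ?_, fun x hx => ?_, ?_⟩
  · by_cases hn : n < m ^ N
    · simp only [hL, hs, dif_pos (And.intro hn hi), if_pos hn]
      refine ⟨by positivity, ?_⟩
      rw [← add_div, div_le_one hm']
      exact_mod_cast (finFunctionFinEquiv.symm ⟨n, hn⟩ ⟨i, hi⟩ : Fin m).2
    · simp [hL, hs, hn]
  · refine (daDiam_box_le hsum N (L n)).trans_lt ((Real.sqrt_lt' hδ).2 ?_)
    have h1 : s n ^ 2 * C ≤ (1 / (m : ℝ)) ^ 2 * C :=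
      mul_le_mul_of_nonneg_right (pow_le_pow_left₀ (hs0 n) (hsle n) 2) hC0
    linarith
  · choose k hk using fun i => exists_fin_div_le hm0 (hx i)
    set n := finFunctionFinEquiv fun i : Fin N => k i with hn
    refine Set.mem_iUnion.2 ⟨n, fun i => ?_⟩
    by_cases hi : i < N
    · rw [boxLo, boxHi, if_pos hi, if_pos hi]
      have h1 : L n i = (k i : ℝ) / m := by
        have h2 : finFunctionFinEquiv.symm n ⟨i, hi⟩ = k i :=
          congrFun (finFunctionFinEquiv.symm_apply_apply fun i : Fin N => k i) _
        simp only [hL]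
        rw [dif_pos ⟨n.2, hi⟩, Fin.eta, h2]
      rw [h1, hs]
      simp only [n.2, if_true]
      exact hk i
    · rw [boxLo, boxHi, if_neg hi, if_neg hi]
      exact hx i
  · have hsum' : ∑ n ∈ Finset.range (m ^ N), ENNReal.ofReal (s n ^ N)
        = ∑ _n ∈ Finset.range (m ^ N), ENNReal.ofReal ((1 / (m : ℝ)) ^ N) :=
      Finset.sum_congr rfl fun n hn => by
        simp only [hs]
        rw [if_pos (Finset.mem_range.1 hn)]
    rw [tsum_eq_sum (s := Finset.range (m ^ N)) fun n hn => by
      rw [Finset.mem_range] at hn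
      simp [hs, hn, hN0.ne'], hsum', Finset.sum_const, Finset.card_range, nsmul_eq_mul,
      ← ENNReal.ofReal_natCast, ← ENNReal.ofReal_mul (by positivity)]
    push_cast
    rw [← mul_pow, mul_one_div_cancel hm'.ne', one_pow, ENNReal.ofReal_one]

end Main

/-- `μ(I^ω) = 1`. -/
theorem ulam_stmt17 (a : ℕ → ℝ) (ha : ∀ i, 0 < a i)
    (hsum : Summable fun i => (a i) ^ 2) :
    muA a cube = 1 := by
  refine le_antisymm (iSup₂_le fun δ hδ => preMu_cube_le_one hsum hδ) ?_
  exact (one_le_preMu_cube ha hsum 1).trans (le_iSup₂ (f := fun δ _ => preMu a δ cube) 1 one_pos)
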